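/- Let K ⊆ (QP_5)_67 be the image of the subspace {f ∈ (P_5^+)_67 : S_5(f) is hit}. Then K is the (internal) direct sum of the three subspaces spanned respectively by the classes of those admissible monomials u of degree 67 in P_5^+ whose weight vector ω(u) equals (3,4,2,2,2), equals (3,4,4,3,1), and equals (3,2,1,1,1,1) (each followed by zeros); in particular K is spanned by the classes of the admissible monomials in P_5^+ of degree 67 with these three weight vectors. -/

import Mathlib

open MvPolynomial

noncomputable section

/-- `P n` is the polynomial algebra `𝔽₂[x_1, …, x_n]`. -/
abbrev P (n : ℕ) : Type := MvPolynomial (Fin n) (ZMod 2)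

/-- The total Steenrod square: the `𝔽₂`-algebra endomorphism of `P n`
with `Sq (x_j) = x_j + x_j ^ 2`. -/
def SqT (n : ℕ) : P n →ₐ[ZMod 2] P n := aeval fun j => X j + X j ^ 2

/-- `u` is hit (in degree `d`): `u = ∑_{i ≥ 1} Sq^i (f i)` where `f i` is homogeneous
of degree `d - i`; here `Sq^i (f i)` is the degree-`d` homogeneous component of
`Sq (f i)`. -/
def IsHit (n d : ℕ) (u : P n) : Prop :=
  ∃ f : ℕ → P n,
    (∀ i, f i ∈ homogeneousSubmodule (Fin n) (ZMod 2) (d - i)) ∧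
    u = ∑ i ∈ Finset.Icc 1 d, homogeneousComponent d (SqT n (f i))

/-- The homogeneous part `(P_n)_d`. -/
abbrev homSub (n d : ℕ) : Submodule (ZMod 2) (P n) := homogeneousSubmodule (Fin n) (ZMod 2) d

/-- The subspace of hit elements of degree `d` (the span of the set of hit elements;
this set is already closed under addition, so this is just the set of hit elements). -/
def hitSub (n d : ℕ) : Submodule (ZMod 2) (P n) := Submodule.span (ZMod 2) {u | IsHit n d u}

/-- The cohit space `(QP_n)_d = (P_n)_d / (A⁺P_n)_d`. -/
abbrev QP (n d : ℕ) : Type :=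
  ↥(homSub n d) ⧸ (hitSub n d).comap (homSub n d).subtype

/-- The class `[f]` in `(QP_n)_d` of a polynomial `f` (via its degree-`d` homogeneous
component; for `f` homogeneous of degree `d` this is the class of `f` itself). -/
def cls (n d : ℕ) (f : P n) : QP n d :=
  Submodule.Quotient.mk
    ⟨homogeneousComponent d f,
      (mem_homogeneousSubmodule _ _).2 (homogeneousComponent_isHomogeneous d f)⟩

/-- The monomial `x^a = x_1^{a_1} ⋯ x_n^{a_n}`. -/
def mono {n : ℕ} (a : Fin n →₀ ℕ) : P n := monomial a 1

/-- The (total) degree of the monomial with exponent vector `a`. -/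
def degA {n : ℕ} (a : Fin n →₀ ℕ) : ℕ := ∑ i, a i

/-- The weight vector: `wVec a t = ω_{t+1}(x^a) = ∑_j α_t(a_j)`. -/
def wVec {n : ℕ} (a : Fin n →₀ ℕ) : ℕ → ℕ :=
  fun t => ∑ j, if Nat.testBit (a j) t then 1 else 0

/-- Left lexicographic (strict) order on sequences. -/
def lexLtN (f g : ℕ → ℕ) : Prop := ∃ i, (∀ j, j < i → f j = g j) ∧ f i < g i

/-- Left lexicographic (strict) order on exponent vectors. -/
def lexLtS {n : ℕ} (a b : Fin n →₀ ℕ) : Prop :=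
  ∃ i : Fin n, (∀ j, j < i → a j = b j) ∧ a i < b i

/-- The order on monomials: `u < v` iff `ω(u) < ω(v)` lexicographically, or
`ω(u) = ω(v)` and `σ(u) < σ(v)` lexicographically. -/
def monLt {n : ℕ} (a b : Fin n →₀ ℕ) : Prop :=
  lexLtN (wVec a) (wVec b) ∨ (wVec a = wVec b ∧ lexLtS a b)

/-- A monomial is admissible iff it is not inadmissible, i.e. there is no finite set of
monomials of the same degree, all smaller than it, such that subtracting their sum
yields a hit polynomial. -/
def Admissible {n : ℕ} (a : Fin n →₀ ℕ) : Prop :=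
  ¬ ∃ S : Finset (Fin n →₀ ℕ),
      (∀ b ∈ S, degA b = degA a ∧ monLt b a) ∧
      IsHit n (degA a) (mono a - ∑ b ∈ S, mono b)

/-- `P_n^0`: the span of the monomials in which some variable has exponent `0`. -/
def PzeroSub (n : ℕ) : Submodule (ZMod 2) (P n) :=
  Submodule.span (ZMod 2) {x : P n | ∃ a : Fin n →₀ ℕ, (∃ i, a i = 0) ∧ x = mono a}

/-- `P_n^+`: the span of the monomials in which every variable occurs. -/
def PplusSub (n : ℕ) : Submodule (ZMod 2) (P n) :=
  Submodule.span (ZMod 2) {x : P n | ∃ a : Fin n →₀ ℕ, (∀ i, 0 < a i) ∧ x = mono a}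

/-- `(QP_n^0)_d`: the image of `(P_n^0)_d` in `(QP_n)_d`. -/
def Qzero (n d : ℕ) : Submodule (ZMod 2) (QP n d) :=
  (((PzeroSub n).comap (homSub n d).subtype)).map
    ((hitSub n d).comap (homSub n d).subtype).mkQ

/-- `(QP_n^+)_d`: the image of `(P_n^+)_d` in `(QP_n)_d`. -/
def Qplus (n d : ℕ) : Submodule (ZMod 2) (QP n d) :=
  (((PplusSub n).comap (homSub n d).subtype)).map
    ((hitSub n d).comap (homSub n d).subtype).mkQ

/-- Kameko-type map `S_5 : P_5 → P_5`, the `𝔽₂`-linear map with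
`S_5(x_1x_2x_3x_4x_5 · y²) = y` on monomials of that form and `S_5 = 0` on all
other monomials. -/
def S5 : P 5 →ₗ[ZMod 2] P 5 :=
  (basisMonomials (Fin 5) (ZMod 2)).constr (ZMod 2) fun a =>
    if ∀ i, Odd (a i) then mono (Finsupp.equivFunOnFinite.symm fun i => a i / 2) else 0

/-- `Φ(f) = x_1x_2x_3x_4x_5 · f²`. -/
def Phi (f : P 5) : P 5 := (∏ i : Fin 5, X i) * f ^ 2

/-- `K ⊆ (QP_5)_67` : the image of the subspace `{f ∈ (P_5^+)_67 : S_5(f) is hit}`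
(expressed as the span of the image of this set, which is a subspace). -/
def KSub : Submodule (ZMod 2) (QP 5 67) :=
  Submodule.span (ZMod 2)
    (((hitSub 5 67).comap (homSub 5 67).subtype).mkQ ''
      {f : homSub 5 67 | (f : P 5) ∈ PplusSub 5 ∧ IsHit 5 31 (S5 (f : P 5))})

/-- The span of the classes of admissible monomials of degree `67` in `P_5^+` with
weight vector `w`. -/
def Vw (w : ℕ → ℕ) : Submodule (ZMod 2) (QP 5 67) :=
  Submodule.span (ZMod 2)
    {x | ∃ a : Fin 5 →₀ ℕ, degA a = 67 ∧ (∀ i, 0 < a i) ∧ Admissible a ∧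
      wVec a = w ∧ x = cls 5 67 (mono a)}

/-- The three weight vectors. -/
def V : Fin 3 → Submodule (ZMod 2) (QP 5 67) :=
  ![Vw fun t => [3, 4, 2, 2, 2].getD t 0,
    Vw fun t => [3, 4, 4, 3, 1].getD t 0,
    Vw fun t => [3, 2, 1, 1, 1, 1].getD t 0]

theorem z2 (c : ZMod 2) : c = 0 ∨ c = 1 := by
  revert c; decide

theorem degA_eq {n : ℕ} (a : Fin n →₀ ℕ) : Finsupp.degree a = degA a := by
  rw [Finsupp.degree_eq_sum, degA]

theorem degA_add {n : ℕ} (a b : Fin n →₀ ℕ) : degA (a + b) = degA a + degA b := by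
  simp [degA, Finset.sum_add_distrib]

theorem degA_smul {n : ℕ} (k : ℕ) (a : Fin n →₀ ℕ) : degA (k • a) = k * degA a := by
  simp [degA, Finset.mul_sum]

theorem mono_add {n : ℕ} (a b : Fin n →₀ ℕ) : mono (a + b) = mono a * mono b := by
  simp [mono, monomial_mul]

theorem mono_smul {n : ℕ} (k : ℕ) (a : Fin n →₀ ℕ) : mono (k • a) = mono a ^ k := by
  simp [mono, monomial_pow]

theorem mono_zero {n : ℕ} : mono (0 : Fin n →₀ ℕ) = 1 := rfl

theorem P_ind {n : ℕ} {Q : P n → Prop} (h0 : Q 0) (hadd : ∀ p q, Q p → Q q → Q (p + q))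
    (hm : ∀ a, Q (mono a)) (p : P n) : Q p := by
  induction p using MvPolynomial.induction_on' with
  | monomial a c =>
    rcases z2 c with rfl | rfl
    · simpa using h0
    · exact hm a
  | add p q hp hq => exact hadd p q hp hq

/-- span of monomials in a set -/
def RS {n : ℕ} (A : Set (Fin n →₀ ℕ)) : Submodule (ZMod 2) (P n) :=
  Submodule.span (ZMod 2) (mono '' A)

theorem mono_mem_RS {n : ℕ} {A : Set (Fin n →₀ ℕ)} {a} (h : a ∈ A) : mono a ∈ RS A :=
  Submodule.subset_span ⟨a, h, rfl⟩

theorem RS_mono {n : ℕ} {A B : Set (Fin n →₀ ℕ)} (h : ∀ a ∈ A, a ∈ B) : RS A ≤ RS B :=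
  Submodule.span_mono (Set.image_mono h)

theorem z2_span_ind {M : Type*} [AddCommGroup M] [Module (ZMod 2) M] {s : Set M} {Q : M → Prop}
    (hm : ∀ x ∈ s, Q x) (h0 : Q 0) (hadd : ∀ p q, Q p → Q q → Q (p + q)) {p : M}
    (hp : p ∈ Submodule.span (ZMod 2) s) : Q p := by
  induction hp using Submodule.span_induction with
  | mem x h => exact hm x h
  | zero => exact h0
  | add x y _ _ hx hy => exact hadd x y hx hy
  | smul c x _ hx =>
    rcases z2 c with rfl | rfl
    · simpa using h0
    · simpa using hx

theorem RS_ind {n : ℕ} {A : Set (Fin n →₀ ℕ)} {Q : P n → Prop} (hm : ∀ a ∈ A, Q (mono a)) (h0 : Q 0)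
    (hadd : ∀ p q, Q p → Q q → Q (p + q)) {p : P n} (hp : p ∈ RS A) : Q p := by
  refine z2_span_ind ?_ h0 hadd hp
  rintro _ ⟨a, ha, rfl⟩
  exact hm a ha

theorem RS_mul {n : ℕ} {A B C : Set (Fin n →₀ ℕ)} (h : ∀ a ∈ A, ∀ b ∈ B, a + b ∈ C) {p q : P n}
    (hp : p ∈ RS A) (hq : q ∈ RS B) : p * q ∈ RS C := by
  refine RS_ind (Q := fun p => p * q ∈ RS C) ?_ (by simp) ?_ hp
  · intro a ha
    refine RS_ind (Q := fun q => mono a * q ∈ RS C) ?_ (by simp) ?_ hq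
    · intro b hb
      rw [← mono_add]
      exact mono_mem_RS (h a ha b hb)
    · intro p q hp hq
      simpa [mul_add] using add_mem hp hq
  · intro p q hp hq
    simpa [add_mul] using add_mem hp hq

theorem two_zero {n : ℕ} (p : P n) : p + p = 0 := CharTwo.add_self_eq_zero p

theorem neg_self {n : ℕ} (p : P n) : -p = p := CharTwo.neg_eq p

theorem sub_eq {n : ℕ} (p q : P n) : p - q = p + q := CharTwo.sub_eq_add p q

theorem pow2_add {n : ℕ} (r : ℕ) (p q : P n) : (p + q) ^ (2 ^ r) = p ^ (2 ^ r) + q ^ (2 ^ r) :=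
  add_pow_char_pow p q 2 r

theorem RS_pow {n : ℕ} {A B : Set (Fin n →₀ ℕ)} (r : ℕ) (h : ∀ a ∈ A, (2 ^ r) • a ∈ B) {p : P n}
    (hp : p ∈ RS A) : p ^ (2 ^ r) ∈ RS B := by
  refine RS_ind (Q := fun p => p ^ (2 ^ r) ∈ RS B) ?_ (by simp) ?_ hp
  · intro a ha
    rw [← mono_smul]
    exact mono_mem_RS (h a ha)
  · intro p q hp hq
    rw [pow2_add]
    exact add_mem hp hq

theorem mem_RS_iff {n : ℕ} {A : Set (Fin n →₀ ℕ)} {p : P n} : p ∈ RS A ↔ ∀ a ∈ p.support, a ∈ A := by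
  have : RS A = restrictSupport (ZMod 2) A := by
    rw [restrictSupport_eq_span]; rfl
  rw [this, mem_restrictSupport_iff]
  rfl

theorem eq_sum_mono {n : ℕ} (p : P n) : p = ∑ a ∈ p.support, mono a := by
  conv_lhs => rw [p.as_sum]
  refine Finset.sum_congr rfl fun a ha => ?_
  rcases z2 (coeff a p) with h | h
  · simp [h] at ha
  · rw [h]; rfl

abbrev hc {n : ℕ} (d : ℕ) : P n →ₗ[ZMod 2] P n := homogeneousComponent d

theorem hc_mono {n : ℕ} (d : ℕ) (a : Fin n →₀ ℕ) : hc d (mono a) = if degA a = d then mono a else 0 := by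
  have : mono a ∈ homogeneousSubmodule (Fin n) (ZMod 2) (degA a) := by
    rw [mem_homogeneousSubmodule]
    exact isHomogeneous_monomial _ (degA_eq a)
  rw [homogeneousComponent_of_mem this]
  simp [eq_comm]

theorem hom_iff {n d : ℕ} {p : P n} : p ∈ homogeneousSubmodule (Fin n) (ZMod 2) d ↔ p ∈ RS {a | degA a = d} := by
  rw [mem_RS_iff]
  constructor
  · intro h a ha
    have := (mem_homogeneousSubmodule _ _).1 h (mem_support_iff.1 ha)
    change degA a = d
    rw [← degA_eq, Finsupp.degree_eq_weight_one]
    exact this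
  · intro h
    rw [eq_sum_mono p]
    refine Submodule.sum_mem _ fun a ha => ?_
    rw [mem_homogeneousSubmodule]
    exact isHomogeneous_monomial _ ((degA_eq a).trans (h a ha))

theorem hc_RS {n d : ℕ} {A : Set (Fin n →₀ ℕ)} {p : P n} (hp : p ∈ RS A) :
    hc d p ∈ RS {a | a ∈ A ∧ degA a = d} := by
  refine RS_ind (Q := fun p => hc d p ∈ RS {a | a ∈ A ∧ degA a = d}) ?_ (by simp) ?_ hp
  · intro a ha
    rw [hc_mono]
    split_ifs with h
    · exact mono_mem_RS ⟨ha, h⟩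
    · exact zero_mem _
  · intro p q hp hq
    rw [map_add]; exact add_mem hp hq

theorem hc_eq_zero {n d : ℕ} {A : Set (Fin n →₀ ℕ)} {p : P n} (hp : p ∈ RS A) (h : ∀ a ∈ A, degA a ≠ d) :
    hc d p = 0 := by
  have := hc_RS (d := d) hp
  have e : {a | a ∈ A ∧ degA a = d} = (∅ : Set (Fin n →₀ ℕ)) := by
    ext a; simp only [Set.mem_ofPred_eq, Set.mem_empty_iff_false, iff_false, not_and]; exact h a
  rw [e] at this
  simpa [RS] using this

theorem hc_mono_mul {n : ℕ} (x : Fin n →₀ ℕ) (d e : ℕ) (h : d = degA x + e) (Q : P n) :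
    hc d (mono x * Q) = mono x * hc e Q := by
  refine P_ind (Q := fun Q => hc d (mono x * Q) = mono x * hc e Q) (by simp) ?_ ?_ Q
  · intro p q hp hq
    rw [mul_add, map_add, hp, hq, map_add, mul_add]
  · intro a
    rw [← mono_add, hc_mono, hc_mono, degA_add]
    by_cases h' : degA a = e
    · rw [if_pos (by omega), if_pos h', mono_add]
    · rw [if_neg (by omega), if_neg h', mul_zero]

theorem hc_pow {n : ℕ} (r E : ℕ) (Q : P n) : hc (2 ^ r * E) (Q ^ (2 ^ r)) = (hc E Q) ^ (2 ^ r) := by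
  refine P_ind (Q := fun Q => hc (2 ^ r * E) (Q ^ (2 ^ r)) = (hc E Q) ^ (2 ^ r)) (by simp) ?_ ?_ Q
  · intro p q hp hq
    rw [pow2_add, map_add, hp, hq, map_add, pow2_add]
  · intro a
    rw [← mono_smul, hc_mono, hc_mono, degA_smul]
    have h2 : 0 < 2 ^ r := by positivity
    by_cases h' : degA a = E
    · rw [if_pos (by rw [h']), if_pos h', mono_smul]
    · rw [if_neg (fun h => h' (Nat.eq_of_mul_eq_mul_left h2 h)), if_neg h']
      simp

/-! Hits -/

theorem IsHit.zero (n d : ℕ) : IsHit n d 0 :=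
  ⟨fun _ => 0, fun _ => zero_mem _, by simp⟩

theorem IsHit.add {n d : ℕ} {u v : P n} (hu : IsHit n d u) (hv : IsHit n d v) : IsHit n d (u + v) := by
  obtain ⟨f, hf, rfl⟩ := hu
  obtain ⟨g, hg, rfl⟩ := hv
  exact ⟨fun i => f i + g i, fun i => add_mem (hf i) (hg i), by simp [Finset.sum_add_distrib]⟩

/-- the submodule of hits -/
def HS (n d : ℕ) : Submodule (ZMod 2) (P n) where
  carrier := {u | IsHit n d u}
  zero_mem' := IsHit.zero n d
  add_mem' := IsHit.add
  smul_mem' c x hx := by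
    rcases z2 c with rfl | rfl
    · simpa using IsHit.zero n d
    · simpa using hx

theorem mem_HS {n d : ℕ} {u : P n} : u ∈ HS n d ↔ IsHit n d u := Iff.rfl

theorem hitSub_eq (n d : ℕ) : hitSub n d = HS n d :=
  Submodule.span_eq (HS n d)

theorem hit_of {n d e : ℕ} {g : P n} (hg : g ∈ RS {a | degA a = e}) (he : e < d) :
    hc d (SqT n g) ∈ HS n d := by
  refine ⟨fun i => if i = d - e then g else 0, fun i => ?_, ?_⟩
  · dsimp only
    split_ifs with h
    · have : d - i = e := by omega
      rw [this]; exact hom_iff.2 hg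
    · exact zero_mem _
  · rw [Finset.sum_eq_single (d - e)]
    · simp
    · intro b _ hb; simp [hb]
    · intro h; exfalso; apply h; simp; omega

theorem hit_span {n d : ℕ} {u : P n} (hu : IsHit n d u) :
    u ∈ Submodule.span (ZMod 2) {v | ∃ a : Fin n →₀ ℕ, degA a < d ∧ v = hc d (SqT n (mono a))} := by
  obtain ⟨f, hf, rfl⟩ := hu
  refine Submodule.sum_mem _ fun i hi => ?_
  rw [Finset.mem_Icc] at hi
  refine RS_ind (Q := fun p => hc d (SqT n p) ∈ Submodule.span (ZMod 2)
    {v | ∃ a : Fin n →₀ ℕ, degA a < d ∧ v = hc d (SqT n (mono a))}) ?_ (by simp) ?_ (hom_iff.1 (hf i))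
  · intro a ha
    have ha : degA a = d - i := ha
    exact Submodule.subset_span ⟨a, by omega, rfl⟩
  · intro p q hp hq
    rw [map_add, map_add]; exact add_mem hp hq

/-- exponents occurring in `(x + x^2)^a` -/
def sq1 : ℕ → ℕ → List ℕ
  | 0, _ => [0]
  | f + 1, a =>
    match a % 2 with
    | 0 => (sq1 f (a / 2)).map (fun c => 2 * c)
    | _ => (sq1 f (a / 2)).flatMap (fun c => [2 * c + 1, 2 * c + 2])

theorem sq1_zero (f : ℕ) {a : ℕ} (h : a % 2 = 0) :
    sq1 (f + 1) a = (sq1 f (a / 2)).map (fun c => 2 * c) := by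
  simp [sq1, h]

theorem sq1_one (f : ℕ) {a : ℕ} (h : a % 2 = 1) :
    sq1 (f + 1) a = (sq1 f (a / 2)).flatMap (fun c => [2 * c + 1, 2 * c + 2]) := by
  simp [sq1, h]

theorem list_sum_sq {n : ℕ} (l : List (P n)) : (l.sum) ^ 2 = (l.map (· ^ 2)).sum := by
  induction l with
  | nil => simp
  | cons x l ih => 
    have := pow2_add 1 x l.sum
    simp only [pow_one] at this
    simp [this, ih]

theorem flatMap_sum {A B : Type*} [AddCommMonoid B] {C : Type*} (l : List A) (f : A → List C) (g : C → B) :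
    ((l.flatMap f).map g).sum = (l.map fun a => ((f a).map g).sum).sum := by
  induction l with
  | nil => simp
  | cons x l ih => simp [ih]

theorem sq1_pow {n : ℕ} (x : P n) (f a : ℕ) (h : a < 2 ^ f) :
    (x + x ^ 2) ^ a = ((sq1 f a).map (fun c => x ^ c)).sum := by
  induction f generalizing a with
  | zero =>
    have : a = 0 := by simpa using h
    subst this; simp [sq1]
  | succ f ih =>
    have h2 : a / 2 < 2 ^ f := by rw [pow_succ] at h; omega
    have e : ((x + x ^ 2) ^ (a / 2)) ^ 2 = ((sq1 f (a / 2)).map (fun c => x ^ (2 * c))).sum := by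
      rw [ih _ h2, list_sum_sq, List.map_map]
      congr 2; funext c; simp [pow_mul, mul_comm]
    rcases Nat.mod_two_eq_zero_or_one a with h0 | h1
    · rw [sq1_zero f h0, List.map_map]
      have : a = a / 2 * 2 := by omega
      conv_lhs => rw [this, pow_mul, e]
      rfl
    · rw [sq1_one f h1, flatMap_sum]
      have : a = a / 2 * 2 + 1 := by omega
      conv_lhs => rw [this, pow_succ, pow_mul, e, ← List.sum_map_mul_right]
      congr 2; funext c; simp; ring

def DR (a c : ℕ) : Prop :=
  a ≤ c ∧ c ≤ 2 * a ∧ ∀ t, (∀ t' < t, c.testBit t' = a.testBit t') → c.testBit t = true → a.testBit t = true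

theorem sq1_DR (f a : ℕ) (h : a < 2 ^ f) : ∀ c ∈ sq1 f a, DR a c := by
  induction f generalizing a with
  | zero =>
    have : a = 0 := by simpa using h
    subst this; simp [sq1, DR]
  | succ f ih =>
    have h2 : a / 2 < 2 ^ f := by rw [pow_succ] at h; omega
    have key : ∀ c c', c' ∈ sq1 f (a / 2) → c / 2 = c' → c % 2 = a % 2 → DR a c := by
      intro c c' hc' hd hm
      obtain ⟨h1, h3, h4⟩ := ih _ h2 c' hc'
      refine ⟨by omega, by omega, ?_⟩
      intro t ht hct
      cases t with
      | zero => simp only [Nat.testBit_zero, decide_eq_true_eq] at *; omega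
      | succ t =>
        rw [Nat.testBit_succ] at hct ⊢
        rw [hd] at hct
        refine h4 t ?_ hct
        intro t' ht'
        have := ht (t' + 1) (by omega)
        rwa [Nat.testBit_succ, Nat.testBit_succ, hd] at this
    intro c hc
    rcases Nat.mod_two_eq_zero_or_one a with h0 | h1
    · rw [sq1_zero f h0, List.mem_map] at hc
      obtain ⟨c', hc', rfl⟩ := hc
      exact key _ c' hc' (by omega) (by omega)
    · rw [sq1_one f h1, List.mem_flatMap] at hc
      obtain ⟨c', hc', hc⟩ := hc
      simp only [List.mem_cons, List.not_mem_nil, or_false] at hc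
      rcases hc with rfl | rfl
      · exact key _ c' hc' (by omega) (by omega)
      · obtain ⟨h3, h4, h5⟩ := ih _ h2 c' hc'
        refine ⟨by omega, by omega, ?_⟩
        intro t ht hct
        cases t with
        | zero => simp only [Nat.testBit_zero, decide_eq_true_eq] at *; omega
        | succ t =>
          have := ht 0 (by omega)
          simp only [Nat.testBit_zero, decide_eq_decide] at this
          omega

theorem SqT_mono {n : ℕ} (a : Fin n →₀ ℕ) : SqT n (mono a) = ∏ j, (X j + X j ^ 2) ^ (a j) := by
  rw [SqT, mono, aeval_monomial, Finsupp.prod_fintype]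
  · simp
  · simp

theorem X_pow_mono {n : ℕ} (j : Fin n) (c : ℕ) : (X j : P n) ^ c = mono (Finsupp.single j c) := by
  rw [X_pow_eq_monomial]; rfl

theorem SqT_DR {n : ℕ} (a : Fin n →₀ ℕ) : SqT n (mono a) ∈ RS {c | ∀ j, DR (a j) (c j)} := by
  rw [SqT_mono]
  have : ∀ s : Finset (Fin n), ∏ j ∈ s, ((X j : P n) + X j ^ 2) ^ (a j) ∈
      RS {c | (∀ j ∈ s, DR (a j) (c j)) ∧ ∀ j, j ∉ s → c j = 0} := by
    intro s
    induction s using Finset.induction_on with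
    | empty => 
      rw [Finset.prod_empty, ← mono_zero]
      exact mono_mem_RS (by simp)
    | insert i s hi ih =>
      rw [Finset.prod_insert hi]
      refine RS_mul (A := {c | DR (a i) (c i) ∧ ∀ j, j ≠ i → c j = 0}) ?_ ?_ ih
      · rintro b ⟨hb, hb'⟩ c ⟨hc, hc'⟩
        constructor
        · intro j hj
          rcases Finset.mem_insert.1 hj with rfl | hj
          · simpa [hc' _ hi] using hb
          · have : j ≠ i := fun h => hi (h ▸ hj)
            simpa [hb' j this] using hc j hj
        · intro j hj
          rw [Finset.mem_insert, not_or] at hj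
          simp [hb' j hj.1, hc' j hj.2]
      · have hlt : a i < 2 ^ (a i) := Nat.lt_two_pow_self
        rw [sq1_pow _ _ _ hlt]
        refine list_sum_mem fun x hx => ?_
        rw [List.mem_map] at hx
        obtain ⟨c, hc, rfl⟩ := hx
        rw [X_pow_mono]
        refine mono_mem_RS ⟨?_, ?_⟩
        · simpa using sq1_DR _ _ hlt c hc
        · intro j hj; simp [Finsupp.single_apply, hj.symm]
  refine RS_mono ?_ (this Finset.univ)
  rintro c ⟨h, -⟩ j
  exact h j (Finset.mem_univ j)

theorem mono_ind {n : ℕ} {Q : (Fin n →₀ ℕ) → Prop} (h0 : Q 0) (hadd : ∀ a b, Q a → Q b → Q (a + b))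
    (hX : ∀ j, Q (Finsupp.single j 1)) (a : Fin n →₀ ℕ) : Q a := by
  induction a using Finsupp.induction_linear with
  | zero => exact h0
  | add f g hf hg => exact hadd f g hf hg
  | single j k =>
    induction k with
    | zero => simpa using h0
    | succ k ih => rw [Finsupp.single_add]; exact hadd _ _ ih (hX j)

theorem SqT_X {n : ℕ} (j : Fin n) : SqT n (mono (Finsupp.single j 1)) = 
    mono (Finsupp.single j 1) + mono (Finsupp.single j 2) := by
  have : mono (Finsupp.single j 1) = (X j : P n) := rfl
  rw [this, SqT, aeval_X, X_pow_mono]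

theorem degA_single {n : ℕ} (j : Fin n) (k : ℕ) : degA (Finsupp.single j k) = k := by
  rw [← degA_eq]; simp

theorem SqT_low {n : ℕ} (a : Fin n →₀ ℕ) : SqT n (mono a) + mono a ∈ RS {c | degA a < degA c} := by
  refine mono_ind (Q := fun a => SqT n (mono a) + mono a ∈ RS {c | degA a < degA c}) ?_ ?_ ?_ a
  · rw [mono_zero, map_one, two_zero]; exact zero_mem _
  · intro a b ha hb
    have ha' : SqT n (mono a) ∈ RS {c | degA a ≤ degA c} := by
      have h1 : mono a ∈ RS {c | degA a ≤ degA c} := mono_mem_RS (by simp)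
      have h2 := RS_mono (B := {c | degA a ≤ degA c}) (fun c hc => Nat.le_of_lt hc) ha
      have := add_mem h2 h1
      rwa [add_assoc, two_zero, add_zero] at this
    have e : SqT n (mono (a + b)) + mono (a + b) =
        SqT n (mono a) * (SqT n (mono b) + mono b) + (SqT n (mono a) + mono a) * mono b := by
      rw [mono_add, map_mul]
      linear_combination - two_zero (SqT n (mono a) * mono b)
    rw [e]
    refine add_mem (RS_mul ?_ ha' hb) (RS_mul ?_ ha (mono_mem_RS (A := {c | c = b}) rfl))
    · intro c hc c' hc'
      simp only [Set.mem_ofPred_eq, degA_add] at *; omega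
    · intro c hc c' hc'
      simp only [Set.mem_ofPred_eq, degA_add] at *; subst hc'; omega
  · intro j
    rw [SqT_X, add_comm, ← add_assoc, two_zero, zero_add]
    exact mono_mem_RS (by simp [degA_single])

theorem SqT_top {n : ℕ} (a : Fin n →₀ ℕ) : SqT n (mono a) + mono (2 • a) ∈ RS {c | degA c < 2 * degA a} := by
  refine mono_ind (Q := fun a => SqT n (mono a) + mono (2 • a) ∈ RS {c | degA c < 2 * degA a}) ?_ ?_ ?_ a
  · rw [smul_zero, mono_zero, map_one, two_zero]; exact zero_mem _
  · intro a b ha hb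
    have ha' : SqT n (mono a) ∈ RS {c | degA c ≤ 2 * degA a} := by
      have h1 : mono (2 • a) ∈ RS {c | degA c ≤ 2 * degA a} := mono_mem_RS (by simp [degA_smul])
      have h2 := RS_mono (B := {c | degA c ≤ 2 * degA a}) (fun c hc => Nat.le_of_lt hc) ha
      have := add_mem h2 h1
      rwa [add_assoc, two_zero, add_zero] at this
    have e : SqT n (mono (a + b)) + mono (2 • (a + b)) =
        SqT n (mono a) * (SqT n (mono b) + mono (2 • b)) + (SqT n (mono a) + mono (2 • a)) * mono (2 • b) := by
      rw [smul_add, mono_add, mono_add, map_mul]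
      linear_combination - two_zero (SqT n (mono a) * mono (2 • b))
    rw [e]
    refine add_mem (RS_mul ?_ ha' hb) (RS_mul ?_ ha (mono_mem_RS (A := {c | c = 2 • b}) rfl))
    · intro c hc c' hc'
      simp only [Set.mem_ofPred_eq, degA_add] at *; omega
    · intro c hc c' hc'
      simp only [Set.mem_ofPred_eq, degA_add] at *; subst hc'; rw [degA_smul]; omega
  · intro j
    have e : mono (2 • Finsupp.single j 1) = (mono (Finsupp.single j 2) : P n) := by
      congr 1; simp
    rw [SqT_X, e, add_assoc, two_zero, add_zero]
    exact mono_mem_RS (by simp [degA_single])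

theorem hc_SqT_top {n : ℕ} (a : Fin n →₀ ℕ) : hc (2 * degA a) (SqT n (mono a)) = mono (2 • a) := by
  have h := hc_eq_zero (d := 2 * degA a) (SqT_top a) (fun c hc => Nat.ne_of_lt hc)
  rw [map_add, hc_mono, degA_smul, if_pos rfl] at h
  rw [← sub_eq] at h
  exact sub_eq_zero.1 h

/-- weight drop at position `t` -/
def DropAt {n : ℕ} (t : ℕ) (b a : Fin n →₀ ℕ) : Prop :=
  (∀ t' < t, wVec b t' = wVec a t') ∧ wVec b t < wVec a t

theorem DR_drop {n : ℕ} {a c : Fin n →₀ ℕ} (h : ∀ j, DR (a j) (c j)) (hne : c ≠ a) (r : ℕ)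
    (hr : ∀ j, a j < 2 ^ r) : ∃ t < r, DropAt t c a := by
  classical
  have hex : ∃ t, ∃ j, (c j).testBit t ≠ (a j).testBit t := by
    by_contra hcon
    push Not at hcon
    apply hne
    ext j
    exact Nat.eq_of_testBit_eq fun t => hcon t j
  let t := Nat.find hex
  have hmin : ∀ t' < t, ∀ j, (c j).testBit t' = (a j).testBit t' := by
    intro t' ht' j
    have := Nat.find_min hex ht'
    push Not at this
    exact this j
  obtain ⟨j0, hj0⟩ := Nat.find_spec hex
  have himp : ∀ j, (c j).testBit t = true → (a j).testBit t = true :=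
    fun j hc => (h j).2.2 t (fun t' ht' => hmin t' ht' j) hc
  have hj0' : (c j0).testBit t ≠ (a j0).testBit t := hj0
  have ha0 : (a j0).testBit t = true := by
    have := himp j0
    revert hj0' this
    cases (c j0).testBit t <;> cases (a j0).testBit t <;> simp
  have hc0 : (c j0).testBit t = false := by
    rw [ha0] at hj0'; simpa using hj0'
  refine ⟨t, ?_, ?_, ?_⟩
  · by_contra hcon
    have : a j0 < 2 ^ t := lt_of_lt_of_le (hr j0) (Nat.pow_le_pow_right (by norm_num) (by omega))
    rw [Nat.testBit_lt_two_pow this] at ha0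
    simp at ha0
  · intro t' ht'
    unfold wVec
    exact Finset.sum_congr rfl fun j _ => by rw [hmin t' ht' j]
  · unfold wVec
    refine Finset.sum_lt_sum ?_ ⟨j0, Finset.mem_univ _, ?_⟩
    · intro j _
      have := himp j
      revert this
      cases (c j).testBit t <;> cases (a j).testBit t <;> simp
    · simp [ha0, hc0]

theorem testBit_low (x e r t : ℕ) (ht : t < r) : (x + 2 ^ r * e).testBit t = x.testBit t := by
  have h1 : (x + 2 ^ r * e) % 2 ^ r = x % 2 ^ r := by simp
  have h2 := Nat.testBit_mod_two_pow (x + 2 ^ r * e) r t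
  have h3 := Nat.testBit_mod_two_pow x r t
  rw [h1, h3] at h2
  simpa [ht] using h2.symm

theorem testBit_high (x e r t : ℕ) (hx : x < 2 ^ r) : (x + 2 ^ r * e).testBit (r + t) = e.testBit t := by
  rw [Nat.add_comm r t, Nat.add_comm x]
  have := Nat.testBit_two_pow_mul_add e hx (t + r)
  rw [this]; simp

theorem wVec_low {n : ℕ} (x e : Fin n →₀ ℕ) (r t : ℕ) (ht : t < r) : wVec (x + 2 ^ r • e) t = wVec x t := by
  unfold wVec
  refine Finset.sum_congr rfl fun j _ => ?_
  have e1 : (x + 2 ^ r • e) j = x j + 2 ^ r * e j := by simp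
  rw [e1, testBit_low _ _ _ _ ht]

theorem wVec_high {n : ℕ} (x e : Fin n →₀ ℕ) (r t : ℕ) (hx : ∀ j, x j < 2 ^ r) :
    wVec (x + 2 ^ r • e) (r + t) = wVec e t := by
  unfold wVec
  refine Finset.sum_congr rfl fun j _ => ?_
  have e1 : (x + 2 ^ r • e) j = x j + 2 ^ r * e j := by simp
  rw [e1, testBit_high _ _ _ _ (hx j)]

/-- main lemma -/
theorem L1 {n : ℕ} (r : ℕ) (x : Fin n →₀ ℕ) (hx : ∀ j, x j < 2 ^ r) (e E : ℕ) (he : e < E) (G : P n)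
    (hG : G ∈ RS {a | degA a = e}) :
    mono x * (hc E (SqT n G)) ^ (2 ^ r) ∈ HS n (degA x + 2 ^ r * E) ⊔
      RS {b | degA b = degA x + 2 ^ r * E ∧ (∀ j, x j ≤ b j) ∧ ∃ t < r, DropAt t b x} := by
  have hR : SqT n (mono x) + mono x ∈ RS {c | (∀ j, DR (x j) (c j)) ∧ c ≠ x} := by
    rw [mem_RS_iff]
    intro c hc
    constructor
    · have h1 := add_mem (SqT_DR x) (mono_mem_RS (A := {c | ∀ j, DR (x j) (c j)}) (a := x)
        (fun j => ⟨le_rfl, by omega, fun _ _ h => h⟩))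
      exact mem_RS_iff.1 h1 c hc
    · rintro rfl
      exact Nat.lt_irrefl _ (mem_RS_iff.1 (SqT_low c) c hc)
  set R := SqT n (mono x) + mono x with hRd
  have hSx : SqT n (mono x) = mono x + R := by
    rw [hRd, add_comm, add_assoc, two_zero, add_zero]
  have hhit : hc (degA x + 2 ^ r * E) (SqT n (mono x * G ^ (2 ^ r))) ∈ HS n (degA x + 2 ^ r * E) := by
    refine hit_of (e := degA x + 2 ^ r * e) ?_ ?_
    · refine RS_mul (A := {a | a = x}) (B := {a | degA a = 2 ^ r * e}) ?_ (mono_mem_RS rfl) (RS_pow r ?_ hG)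
      · rintro a rfl b hb
        simp only [Set.mem_ofPred_eq, degA_add] at *; omega
      · intro a ha
        simp only [Set.mem_ofPred_eq, degA_smul] at *; rw [ha]
    · have := Nat.mul_lt_mul_of_pos_left he (show 0 < 2 ^ r by positivity)
      omega
  have heq : hc (degA x + 2 ^ r * E) (SqT n (mono x * G ^ (2 ^ r))) =
      mono x * (hc E (SqT n G)) ^ (2 ^ r) + hc (degA x + 2 ^ r * E) (R * (SqT n G) ^ (2 ^ r)) := by
    rw [map_mul, map_pow, hSx, add_mul, map_add, hc_mono_mul x _ _ rfl, hc_pow]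
  have hfin : mono x * (hc E (SqT n G)) ^ (2 ^ r) =
      hc (degA x + 2 ^ r * E) (SqT n (mono x * G ^ (2 ^ r))) +
      hc (degA x + 2 ^ r * E) (R * (SqT n G) ^ (2 ^ r)) := by
    rw [heq, add_assoc, two_zero, add_zero]
  rw [hfin]
  refine Submodule.add_mem_sup hhit ?_
  have h1 : SqT n G ∈ RS Set.univ := mem_RS_iff.2 (by simp)
  have h2 : (SqT n G) ^ (2 ^ r) ∈ RS {c | ∃ e : Fin n →₀ ℕ, c = 2 ^ r • e} := 
    RS_pow r (fun a _ => by exact ⟨a, rfl⟩) h1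
  have h3 : R * (SqT n G) ^ (2 ^ r) ∈ RS {b | (∀ j, x j ≤ b j) ∧ ∃ t < r, DropAt t b x} := by
    refine RS_mul ?_ hR h2
    rintro c ⟨hc, hne⟩ _ ⟨e, rfl⟩
    refine ⟨fun j => ?_, ?_⟩
    · have := (hc j).1
      simp only [Finsupp.coe_add, Pi.add_apply]; omega
    · obtain ⟨t, ht, hd1, hd2⟩ := DR_drop hc hne r hx
      refine ⟨t, ht, ?_, ?_⟩
      · intro t' ht'
        rw [wVec_low _ _ _ _ (by omega)]; exact hd1 t' ht'
      · rw [wVec_low _ _ _ _ ht]; exact hd2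
  refine RS_mono ?_ (hc_RS h3)
  rintro b ⟨⟨h1, h2⟩, h3⟩
  exact ⟨h3, h1, h2⟩

/-- inadmissibility in span form -/
def Inad {n : ℕ} (d : ℕ) (a : Fin n →₀ ℕ) : Prop :=
  mono a ∈ HS n d ⊔ RS {b | degA b = d ∧ monLt b a}

theorem Inad.not_adm {n : ℕ} {a : Fin n →₀ ℕ} (h : Inad (degA a) a) : ¬ Admissible a := by
  intro hA
  obtain ⟨u, hu, v, hv, e⟩ := Submodule.mem_sup.1 h
  refine hA ⟨v.support, fun b hb => mem_RS_iff.1 hv b hb, ?_⟩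
  rw [← eq_sum_mono, ← e, add_sub_cancel_right]
  exact hu

theorem inad_of_not {n : ℕ} {a : Fin n →₀ ℕ} (h : ¬ Admissible a) : Inad (degA a) a := by
  unfold Admissible at h
  push Not at h
  obtain ⟨S, hS, hh⟩ := h
  refine Submodule.mem_sup.2 ⟨_, hh, ∑ b ∈ S, mono b, ?_, by simp⟩
  exact Submodule.sum_mem _ fun b hb => mono_mem_RS (hS b hb)

def Blk {n : ℕ} (s : ℕ) (w : Fin n →₀ ℕ) (tail : Bool) : Prop :=
  mono w ∈ Submodule.span (ZMod 2) {v | ∃ h : Fin n →₀ ℕ, degA h < degA w ∧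
      (degA w < degA h + 2 ^ s ∨ tail = true) ∧ v = hc (degA w) (SqT n (mono h))} ⊔
    RS {b | degA b = degA w ∧ monLt b w}

theorem SqT_ge {n : ℕ} (a : Fin n →₀ ℕ) : SqT n (mono a) ∈ RS {c | degA a ≤ degA c} := by
  refine RS_mono ?_ (SqT_DR a)
  intro c hc
  exact Finset.sum_le_sum fun j _ => (hc j).1

theorem wVec_zero_of_lt {n : ℕ} {w : Fin n →₀ ℕ} {s t : ℕ} (hw : ∀ j, w j < 2 ^ s) (ht : s ≤ t) :
    wVec w t = 0 := by
  unfold wVec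
  refine Finset.sum_eq_zero fun j _ => ?_
  rw [Nat.testBit_lt_two_pow]; · simp
  exact lt_of_lt_of_le (hw j) (Nat.pow_le_pow_right (by norm_num) ht)

theorem lt_of_wVec_zero {n : ℕ} {w : Fin n →₀ ℕ} {s : ℕ} (hw : ∀ t, s ≤ t → wVec w t = 0) (j : Fin n) :
    w j < 2 ^ s := by
  refine Nat.lt_pow_two_of_testBit _ fun i hi => ?_
  have := hw i hi
  unfold wVec at this
  rw [Finset.sum_eq_zero_iff] at this
  have := this j (Finset.mem_univ j)
  revert this
  cases (w j).testBit i <;> simp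

/-- composition of monLt in the middle block -/
theorem monLt_block {n : ℕ} (r s : ℕ) (x w b y : Fin n →₀ ℕ) (hx : ∀ j, x j < 2 ^ r)
    (hw : ∀ j, w j < 2 ^ s) (h : monLt b w) :
    monLt (x + 2 ^ r • (b + 2 ^ s • y)) (x + 2 ^ r • (w + 2 ^ s • y)) := by
  rcases h with ⟨i, hi, hlt⟩ | ⟨he, i, hi, hlt⟩
  · have his : i < s := by
      by_contra hc
      rw [wVec_zero_of_lt hw (by omega)] at hlt
      omega
    refine Or.inl ⟨r + i, ?_, ?_⟩
    · intro j hj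
      by_cases hjr : j < r
      · rw [wVec_low _ _ _ _ hjr, wVec_low _ _ _ _ hjr]
      · obtain ⟨k, rfl⟩ : ∃ k, j = r + k := ⟨j - r, by omega⟩
        rw [wVec_high _ _ _ _ hx, wVec_high _ _ _ _ hx, wVec_low _ _ _ _ (by omega), wVec_low _ _ _ _ (by omega)]
        exact hi k (by omega)
    · rw [wVec_high _ _ _ _ hx, wVec_high _ _ _ _ hx, wVec_low _ _ _ _ (by omega), wVec_low _ _ _ _ (by omega)]
      exact hlt
  · have hb : ∀ j, b j < 2 ^ s := lt_of_wVec_zero fun t ht => by rw [he, wVec_zero_of_lt hw ht]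
    refine Or.inr ⟨?_, i, ?_, ?_⟩
    · funext j
      by_cases hjr : j < r
      · rw [wVec_low _ _ _ _ hjr, wVec_low _ _ _ _ hjr]
      · obtain ⟨k, rfl⟩ : ∃ k, j = r + k := ⟨j - r, by omega⟩
        rw [wVec_high _ _ _ _ hx, wVec_high _ _ _ _ hx]
        by_cases hks : k < s
        · rw [wVec_low _ _ _ _ (by omega), wVec_low _ _ _ _ (by omega), he]
        · obtain ⟨l, rfl⟩ : ∃ l, k = s + l := ⟨k - s, by omega⟩
          rw [wVec_high _ _ _ _ hb, wVec_high _ _ _ _ hw]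
    · intro j hj
      simp [hi j hj]
    · have : 0 < 2 ^ r := by positivity
      simp only [Finsupp.coe_add, Pi.add_apply, Finsupp.coe_smul, Pi.smul_apply, smul_eq_mul]
      have := Nat.mul_lt_mul_of_pos_left (show b i + 2 ^ s * y i < w i + 2 ^ s * y i by omega) this
      omega

theorem block_inad {n : ℕ} (r s : ℕ) (x w y : Fin n →₀ ℕ) (tail : Bool) (hx : ∀ j, x j < 2 ^ r)
    (hw : ∀ j, w j < 2 ^ s) (hy : tail = true → y = 0) (hB : Blk s w tail) :
    Inad (degA (x + 2 ^ r • (w + 2 ^ s • y))) (x + 2 ^ r • (w + 2 ^ s • y)) := by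
  set D := degA (x + 2 ^ r • (w + 2 ^ s • y)) with hD
  set a := x + 2 ^ r • (w + 2 ^ s • y) with ha
  let T : Submodule (ZMod 2) (P n) := HS n D ⊔ RS {b | degA b = D ∧ monLt b a}
  have hφ : ∀ p q : P n, mono x * ((p + q) * mono (2 ^ s • y)) ^ (2 ^ r) =
      mono x * (p * mono (2 ^ s • y)) ^ (2 ^ r) + mono x * (q * mono (2 ^ s • y)) ^ (2 ^ r) := by
    intro p q
    rw [add_mul, pow2_add, mul_add]
  have h0 : mono x * ((0 : P n) * mono (2 ^ s • y)) ^ (2 ^ r) = 0 := by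
    rw [zero_mul, zero_pow (by positivity), mul_zero]
  have hDe : D = degA x + 2 ^ r * (degA w + 2 ^ s * degA y) := by
    rw [hD, degA_add, degA_smul, degA_add, degA_smul]
  unfold Inad
  have hgoal : mono a = mono x * (mono w * mono (2 ^ s • y)) ^ (2 ^ r) := by
    rw [ha, mono_add, mono_smul, mono_add]
  rw [hgoal]
  obtain ⟨u, hu, v, hv, e⟩ := Submodule.mem_sup.1 hB
  rw [← e, hφ]
  refine add_mem ?_ ?_
  · refine z2_span_ind (Q := fun u => mono x * (u * mono (2 ^ s • y)) ^ (2 ^ r) ∈ T) ?_ ?_ ?_ hu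
    · rintro _ ⟨h, h1, h2, rfl⟩
      have key : hc (degA w) (SqT n (mono h)) * mono (2 ^ s • y) =
          hc (degA w + 2 ^ s * degA y) (SqT n (mono (h + 2 ^ s • y))) := by
        rcases h2 with h2 | h2
        · have hR := SqT_low y
          set R := SqT n (mono y) + mono y with hRd
          have hSy : SqT n (mono y) = mono y + R := by
            rw [hRd, add_comm, add_assoc, two_zero, add_zero]
          have hz : hc (degA w + 2 ^ s * degA y) (SqT n (mono h) * R ^ (2 ^ s)) = 0 := by
            refine hc_eq_zero (RS_mul (A := {c | degA h ≤ degA c}) (B := {c | 2 ^ s * (degA y + 1) ≤ degA c})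
              (C := {c | degA w + 2 ^ s * degA y < degA c}) ?_ (SqT_ge h) (RS_pow s ?_ hR)) ?_
            · intro c hc c' hc'
              simp only [Set.mem_ofPred_eq, degA_add, mul_add, mul_one] at *; omega
            · intro c hc
              simp only [Set.mem_ofPred_eq, degA_smul] at *
              exact Nat.mul_le_mul_left _ hc
            · intro c hc hc'
              simp only [Set.mem_ofPred_eq] at *; omega
          rw [mono_add, map_mul, mono_smul, map_pow, hSy, pow2_add, mul_add, map_add, hz, add_zero,
            ← mono_smul, mul_comm (SqT n (mono h)), hc_mono_mul (2 ^ s • y) _ (degA w), mul_comm]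
          rw [degA_smul]; omega
        · have := hy h2
          subst this
          simp [mono_zero, degA]
      rw [key]
      have := L1 r x hx (degA h + 2 ^ s * degA y) (degA w + 2 ^ s * degA y) (by omega)
        (mono (h + 2 ^ s • y)) (mono_mem_RS (by simp [degA_add, degA_smul]))
      rw [← hDe] at this
      refine sup_le_sup_left (RS_mono ?_) _ this
      rintro b ⟨hb1, -, t, ht, hd, hd'⟩
      refine ⟨hb1, Or.inl ⟨t, ?_, ?_⟩⟩
      · intro j hj
        rw [ha, wVec_low _ _ _ _ (by omega)]
        exact hd j hj
      · rw [ha, wVec_low _ _ _ _ (by omega)]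
        exact hd'
    · rw [h0]; exact zero_mem _
    · intro p q hp hq
      rw [hφ]; exact add_mem hp hq
  · refine Submodule.mem_sup_right ?_
    refine RS_ind (Q := fun u => mono x * (u * mono (2 ^ s • y)) ^ (2 ^ r) ∈ RS {b | degA b = D ∧ monLt b a}) ?_ ?_ ?_ hv
    · rintro b ⟨hb1, hb2⟩
      rw [← mono_add, ← mono_smul, ← mono_add]
      refine mono_mem_RS ⟨?_, ?_⟩
      · rw [hDe, degA_add, degA_smul, degA_add, degA_smul, hb1]
      · exact monLt_block r s x w b y hx hw hb2
    · rw [h0]; exact zero_mem _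
    · intro p q hp hq
      rw [hφ]; exact add_mem hp hq

theorem blk_of_hit {n : ℕ} (s : ℕ) (v : Fin n →₀ ℕ) (h : mono v ∈ HS n (degA v)) : Blk s v true := by
  refine Submodule.mem_sup_left (Submodule.span_mono ?_ (hit_span h))
  rintro _ ⟨a, ha, rfl⟩
  exact ⟨a, ha, Or.inr rfl, rfl⟩

theorem suffix_hit {n : ℕ} (r : ℕ) (x v : Fin n →₀ ℕ) (hx : ∀ j, x j < 2 ^ r)
    (h : mono v ∈ HS n (degA v)) : Inad (degA (x + 2 ^ r • v)) (x + 2 ^ r • v) := by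
  obtain ⟨s, hs⟩ : ∃ s, ∀ j, v j < 2 ^ s := by
    refine ⟨∑ j, v j, fun j => lt_of_le_of_lt ?_ Nat.lt_two_pow_self⟩
    exact Finset.single_le_sum (f := fun j => v j) (fun _ _ => Nat.zero_le _) (Finset.mem_univ j)
  have := block_inad r s x v 0 true hx hs (fun _ => rfl) (blk_of_hit s v h)
  simpa using this

theorem hit_even {n : ℕ} (u : Fin n →₀ ℕ) (hu : 0 < degA u) : mono (2 • u) ∈ HS n (degA (2 • u)) := by
  rw [degA_smul, ← hc_SqT_top]
  exact hit_of (e := degA u) (mono_mem_RS rfl) (by omega)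

theorem SqT_Xpow {n : ℕ} (j : Fin n) (i : ℕ) : SqT n (mono (Finsupp.single j (2 ^ i))) =
    mono (Finsupp.single j (2 ^ i)) + mono (Finsupp.single j (2 ^ (i + 1))) := by
  have h : ∀ k i, (mono (Finsupp.single j (2 ^ i * k)) : P n) = mono (Finsupp.single j k) ^ (2 ^ i) := by
    intro k i
    rw [← mono_smul]; simp
  have h1 := h 1 i
  have h2 := h 2 i
  rw [mul_one] at h1
  rw [pow_succ, h1, h2, map_pow, SqT_X, pow2_add]

theorem chain {n : ℕ} (j : Fin n) (u : Fin n →₀ ℕ) (hp : ∀ i, degA u + 1 ≠ 2 ^ i) (k : ℕ) :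
    ∀ i, k + 2 ^ i = degA u + 1 →
    mono (Finsupp.single j (2 ^ i)) * hc (degA u + k) (SqT n (mono u)) ∈ HS n (2 * degA u + 1) := by
  induction k using Nat.strong_induction_on with
  | _ k ih =>
    intro i hi
    have hk : 0 < k := by
      rcases Nat.eq_zero_or_pos k with rfl | h
      · exact absurd hi.symm (by simpa using hp i)
      · exact h
    have hpos : 0 < 2 ^ i := by positivity
    have h1 : hc (2 * degA u + 1) (SqT n (mono (Finsupp.single j (2 ^ i) + u))) ∈ HS n (2 * degA u + 1) := by
      refine hit_of (e := 2 ^ i + degA u) (mono_mem_RS ?_) (by omega)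
      simp [degA_add, degA_single]
    rw [mono_add, map_mul, SqT_Xpow, add_mul, map_add,
      hc_mono_mul _ _ (degA u + k) (by rw [degA_single]; omega)] at h1
    have h2 : hc (2 * degA u + 1) (mono (Finsupp.single j (2 ^ (i + 1))) * SqT n (mono u)) ∈
        HS n (2 * degA u + 1) := by
      by_cases hki : 2 ^ i ≤ k
      · rw [hc_mono_mul _ _ (degA u + (k - 2 ^ i)) (by rw [degA_single, pow_succ]; omega)]
        exact ih _ (by omega) _ (by rw [pow_succ]; omega)
      · rw [hc_eq_zero (RS_mul (A := {c | c = Finsupp.single j (2 ^ (i + 1))}) (B := {c | degA u ≤ degA c})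
          (C := {c | 2 * degA u + 1 < degA c}) ?_ (mono_mem_RS rfl) (SqT_ge u))]
        · exact zero_mem _
        · intro c hc
          exact Nat.ne_of_gt hc
        · rintro c rfl c' hc'
          simp only [Set.mem_ofPred_eq, degA_add, degA_single, pow_succ] at *; omega
    have := sub_mem h1 h2
    rwa [add_sub_cancel_right] at this

theorem hit_one {n : ℕ} (j : Fin n) (u : Fin n →₀ ℕ) (hp : ∀ i, degA u + 1 ≠ 2 ^ i) :
    mono (Finsupp.single j 1 + 2 • u) ∈ HS n (degA (Finsupp.single j 1 + 2 • u)) := by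
  have := chain j u hp (degA u) 0 (by simp)
  rw [← two_mul, hc_SqT_top, pow_zero, ← mono_add] at this
  rw [degA_add, degA_smul, degA_single, add_comm 1]
  exact this

def pc (m : ℕ) : ℕ := (m.testBit 0).toNat + (m.testBit 1).toNat + (m.testBit 2).toNat +
  (m.testBit 3).toNat + (m.testBit 4).toNat

def bitv (m : ℕ) : Fin 5 →₀ ℕ := Finsupp.equivFunOnFinite.symm fun j => (m.testBit j).toNat

theorem bitv_apply (m : ℕ) (j : Fin 5) : bitv m j = (m.testBit j).toNat := rfl

theorem toNat_le (b : Bool) : b.toNat < 2 := by cases b <;> simp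

theorem degA_bitv (m : ℕ) : degA (bitv m) = pc m := by
  simp [degA, Fin.sum_univ_five, bitv_apply, pc]

theorem wVec_bitv (m : ℕ) : wVec (bitv m) 0 = pc m := by
  rw [← degA_bitv]
  unfold wVec degA
  refine Finset.sum_congr rfl fun j _ => ?_
  rw [bitv_apply]
  cases m.testBit j <;> simp

def expo : List ℕ → (Fin 5 →₀ ℕ)
  | [] => 0
  | m :: l => bitv m + 2 • expo l

theorem expo_append (l l' : List ℕ) : expo (l ++ l') = expo l + 2 ^ l.length • expo l' := by
  induction l with
  | nil => simp [expo]
  | cons m l ih =>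
    rw [List.cons_append, expo, ih, expo, List.length_cons, pow_succ, smul_add, add_assoc, smul_smul, mul_comm]

theorem expo_lt (l : List ℕ) (j : Fin 5) : expo l j < 2 ^ l.length := by
  induction l with
  | nil => simp [expo]
  | cons m l ih =>
    rw [expo, List.length_cons, pow_succ]
    simp only [Finsupp.coe_add, Pi.add_apply, Finsupp.coe_smul, Pi.smul_apply, smul_eq_mul, bitv_apply]
    have := toNat_le (m.testBit j)
    omega

theorem wVec_expo (l : List ℕ) (t : ℕ) : wVec (expo l) t = (l.map pc).getD t 0 := by
  induction l generalizing t with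
  | nil => simp [expo, wVec]
  | cons m l ih =>
    have hb : ∀ j, bitv m j < 2 ^ 1 := fun j => by rw [bitv_apply]; simpa using toNat_le _
    have e : expo (m :: l) = bitv m + 2 ^ 1 • expo l := by rw [pow_one]; rfl
    rw [e]
    cases t with
    | zero => rw [wVec_low _ _ _ _ (by norm_num), wVec_bitv]; simp
    | succ t => rw [add_comm t 1, wVec_high _ _ _ _ hb, ih, add_comm 1 t]; simp

def maskOf (u : Fin 5 →₀ ℕ) : ℕ := u 0 % 2 + 2 * (u 1 % 2) + 4 * (u 2 % 2) + 8 * (u 3 % 2) + 16 * (u 4 % 2)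

theorem maskOf_lt (u : Fin 5 →₀ ℕ) : maskOf u < 32 := by
  unfold maskOf; omega

theorem mask_aux : ∀ a < 2, ∀ b < 2, ∀ c < 2, ∀ d < 2, ∀ e < 2, ∀ j : Fin 5,
    ((a + 2 * b + 4 * c + 8 * d + 16 * e).testBit j).toNat = ![a, b, c, d, e] j := by decide +kernel

theorem bitv_maskOf (u : Fin 5 →₀ ℕ) (j : Fin 5) : bitv (maskOf u) j = u j % 2 := by
  rw [bitv_apply, maskOf, mask_aux _ (by omega) _ (by omega) _ (by omega) _ (by omega) _ (by omega)]
  fin_cases j <;> rfl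

def half (u : Fin 5 →₀ ℕ) : Fin 5 →₀ ℕ := Finsupp.equivFunOnFinite.symm fun j => u j / 2

theorem half_eq (u : Fin 5 →₀ ℕ) : bitv (maskOf u) + 2 • half u = u := by
  ext j
  simp only [Finsupp.coe_add, Pi.add_apply, Finsupp.coe_smul, Pi.smul_apply, smul_eq_mul, bitv_maskOf]
  have : half u j = u j / 2 := rfl
  rw [this]; omega

def masks : ℕ → List ℕ
  | 0 => [0]
  | 1 => [1, 2, 4, 8, 16]
  | 2 => [3, 5, 6, 9, 10, 12, 17, 18, 20, 24]
  | 3 => [7, 11, 13, 14, 19, 21, 22, 25, 26, 28]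
  | 4 => [15, 23, 27, 29, 30]
  | _ => [31]

theorem mem_masks : ∀ m < 32, m ∈ masks (pc m) := by decide +kernel

theorem pc_le : ∀ m < 32, pc m ≤ 5 := by decide +kernel

theorem pc_zero : ∀ m < 32, pc m = 0 → m = 0 := by decide +kernel

theorem pc_one : ∀ m < 32, pc m = 1 → ∃ j : Fin 5, m = 2 ^ (j : ℕ) := by decide +kernel

theorem bitv_zero : bitv 0 = 0 := by
  ext j; simp [bitv_apply]

theorem bitv_pow (j : Fin 5) : bitv (2 ^ (j : ℕ)) = Finsupp.single j 1 := by
  ext i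
  rw [bitv_apply, Nat.testBit_two_pow, Finsupp.single_apply]
  by_cases h : j = i
  · simp [h]
  · have : (j : ℕ) ≠ i := fun h' => h (Fin.ext h')
    simp [h, this]

def enc : List ℕ → ℕ
  | [] => 1
  | m :: l => 32 * enc l + m

theorem enc_pos (l : List ℕ) : 0 < enc l := by
  induction l with
  | nil => simp [enc]
  | cons m l ih => rw [enc]; omega

theorem enc_inj (l : List ℕ) : ∀ l', (∀ m ∈ l, m < 32) → (∀ m ∈ l', m < 32) → enc l = enc l' → l = l' := by
  induction l with
  | nil =>
    intro l' _ h2 h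
    cases l' with
    | nil => rfl
    | cons m l' =>
      have := enc_pos l'
      simp only [enc] at h; omega
  | cons m l ih =>
    intro l' h1 h2 h
    cases l' with
    | nil =>
      have := enc_pos l
      simp only [enc] at h; omega
    | cons m' l' =>
      have a1 := h1 m (by simp)
      have a2 := h2 m' (by simp)
      simp only [enc] at h
      have e1 : m = m' := by omega
      have e2 : enc l = enc l' := by omega
      rw [e1, ih l' (fun x hx => h1 x (by simp [hx])) (fun x hx => h2 x (by simp [hx])) e2]

def look (T : ℕ → Bool) (ss : List ℕ) (pre : List ℕ) : Bool := ss.any fun s => T (enc (pre.take s))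

def cover (S T : ℕ → Bool) : List ℕ → List ℕ → Bool
  | [], pre => (List.range 5).any (fun j => pre.all fun m => !m.testBit j) || look T [3, 4] pre
  | k :: ws, pre => (masks k).all fun m => look S [2, 3, 4] (m :: pre) || cover S T ws (m :: pre)

def TabOK (T : ℕ → Bool) (tail : Bool) : Prop :=
  ∀ l : List ℕ, (∀ m ∈ l, m < 32) → T (enc l) = true → Blk l.length (expo l.reverse) tail

theorem look_inad {T : ℕ → Bool} {tail : Bool} (hT : TabOK T tail) (ss pre l : List ℕ) (hp : ∀ m ∈ pre, m < 32)
    (hl : tail = true → l = []) (h : look T ss pre = true) :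
    Inad (degA (expo (pre.reverse ++ l))) (expo (pre.reverse ++ l)) := by
  unfold look at h
  rw [List.any_eq_true] at h
  obtain ⟨s, -, hs⟩ := h
  have hB := hT _ (fun m hm => hp m (List.mem_of_mem_take hm)) hs
  have e : pre.reverse ++ l = (pre.drop s).reverse ++ ((pre.take s).reverse ++ l) := by
    rw [← List.append_assoc, ← List.reverse_append, List.take_append_drop]
  rw [e, expo_append, expo_append]
  refine block_inad _ _ _ _ _ tail (expo_lt _) (expo_lt _) ?_ ?_
  · intro ht; rw [hl ht]; rfl
  · rw [List.length_reverse]; exact hB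

theorem expo_zero (l : List ℕ) (j : Fin 5) (h : ∀ m ∈ l, m.testBit j = false) : expo l j = 0 := by
  induction l with
  | nil => rfl
  | cons m l ih =>
    rw [expo]
    simp only [Finsupp.coe_add, Pi.add_apply, Finsupp.coe_smul, Pi.smul_apply, smul_eq_mul, bitv_apply]
    rw [ih fun m hm => h m (by simp [hm]), h m (by simp)]; rfl

theorem cover_inad {S T : ℕ → Bool} (hS : TabOK S false) (hT : TabOK T true) (ws : List ℕ) :
    ∀ pre, (∀ m ∈ pre, m < 32) → cover S T ws pre = true → ∀ l, (∀ m ∈ l, m < 32) → l.map pc = ws →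
    (∀ j, 0 < expo (pre.reverse ++ l) j) →
    Inad (degA (expo (pre.reverse ++ l))) (expo (pre.reverse ++ l)) := by
  induction ws with
  | nil =>
    intro pre hpre h l hl hm hpos
    have : l = [] := by simpa using hm
    subst this
    rw [cover, Bool.or_eq_true] at h
    rcases h with h | h
    · rw [List.any_eq_true] at h
      obtain ⟨j, hj, h⟩ := h
      rw [List.mem_range] at hj
      rw [List.all_eq_true] at h
      have := hpos ⟨j, hj⟩
      rw [expo_zero _ _ (fun m hm => ?_)] at this
      · exact absurd this (lt_irrefl _)
      · have := h m (by simpa using hm)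
        simpa using this
    · exact look_inad hT _ _ _ hpre (fun _ => rfl) h
  | cons k ws ih =>
    intro pre hpre h l hl hm hpos
    cases l with
    | nil => simp at hm
    | cons m l =>
      rw [List.map_cons, List.cons.injEq] at hm
      have hm32 := hl m (by simp)
      rw [cover, List.all_eq_true] at h
      have h := h m (hm.1 ▸ mem_masks m hm32)
      have e : pre.reverse ++ m :: l = (m :: pre).reverse ++ l := by simp
      have hpre' : ∀ m' ∈ m :: pre, m' < 32 := by
        intro m' hm'
        rcases List.mem_cons.1 hm' with rfl | h'
        · exact hm32
        · exact hpre _ h'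
      rw [e] at hpos ⊢
      rw [Bool.or_eq_true] at h
      rcases h with h | h
      · exact look_inad hS _ _ _ hpre' (fun h => by simp at h) h
      · exact ih _ hpre' h l (fun x hx => hl x (by simp [hx])) hm.2 hpos

def goodW : List (List ℕ) := [[3, 4, 2, 2, 2], [3, 4, 4, 3, 1], [3, 2, 1, 1, 1, 1]]

def badW : List (List ℕ) := [[3, 2, 1, 1, 3], [3, 2, 1, 3, 2], [3, 2, 1, 5, 1], [3, 2, 3, 2, 2],
  [3, 2, 3, 4, 1], [3, 2, 5, 3, 1], [3, 2, 5, 5], [3, 4, 2, 4, 1], [3, 4, 4, 5]]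

def coverW : ℕ → ℕ → List ℕ → Bool
  | 0, _, _ => false
  | f + 1, d, ws =>
    match d with
    | 0 => goodW.contains ws.reverse || badW.contains ws.reverse
    | d + 1 => [1, 2, 3, 4, 5].all fun k =>
      decide (k % 2 ≠ (d + 1) % 2) || decide (d + 1 < k) || (k == 5 && ws.isEmpty) ||
      (k == 1 && decide (2 ^ (Nat.log2 (d / 2 + 1)) ≠ d / 2 + 1)) || coverW f ((d + 1 - k) / 2) (k :: ws)

theorem coverW_start : coverW 8 67 [] = true := by decide +kernel

theorem not_pow {N : ℕ} (h : 2 ^ (Nat.log2 N) ≠ N) (i : ℕ) : N ≠ 2 ^ i := by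
  rintro rfl
  rw [Nat.log2_two_pow] at h
  exact h rfl

theorem coverW_thm {S T : ℕ → Bool} (hS : TabOK S false) (hT : TabOK T true)
    (hb : badW.all (fun ws => cover S T ws []) = true) (f : ℕ) :
    ∀ d (pre : List ℕ), (∀ m ∈ pre, m < 32) → coverW f d (pre.map pc) = true →
    ∀ u : Fin 5 →₀ ℕ, degA u = d → ∀ a, a = expo pre.reverse + 2 ^ pre.length • u → wVec a 0 < 5 →
    (∀ j, 0 < a j) → Inad (degA a) a ∨ ∃ w ∈ goodW, wVec a = fun t => w.getD t 0 := by
  induction f with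
  | zero => intro d pre _ h; simp [coverW] at h
  | succ f ih =>
    intro d pre hpre h u hu a ha h5 hpos
    cases d with
    | zero =>
      have hu0 : u = 0 := by
        ext j
        have : ∑ i, u i = 0 := hu
        rw [Finset.sum_eq_zero_iff] at this
        exact this j (Finset.mem_univ j)
      subst hu0
      have ha' : a = expo pre.reverse := by rw [ha]; simp
      have hrev : (pre.map pc).reverse = pre.reverse.map pc := by simp
      rw [coverW, hrev, Bool.or_eq_true, List.contains_iff_mem, List.contains_iff_mem] at h
      rcases h with h | h
      · refine Or.inr ⟨_, h, ?_⟩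
        funext t
        rw [ha', wVec_expo]
      · left
        rw [List.all_eq_true] at hb
        have := cover_inad hS hT _ [] (by simp) (hb _ h) pre.reverse
          (fun m hm => hpre m (by simpa using hm)) rfl
        simp only [List.reverse_nil, List.nil_append] at this
        rw [ha'] at hpos ⊢
        exact this hpos
    | succ d =>
      have hue := half_eq u
      set m := maskOf u with hm
      set u' := half u with hu'
      have hm32 : m < 32 := maskOf_lt u
      have hx : ∀ j, expo pre.reverse j < 2 ^ pre.length := fun j => by
        simpa using expo_lt pre.reverse j
      have hdeg : pc m + 2 * degA u' = d + 1 := by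
        rw [← hu, ← hue, degA_add, degA_smul, degA_bitv]
      have hpc := pc_le m hm32
      by_cases h0 : pc m = 0
      · left
        rw [ha]
        refine suffix_hit _ _ _ hx ?_
        rw [← hue, pc_zero m hm32 h0, bitv_zero, zero_add]
        exact hit_even _ (by omega)
      · rw [coverW, List.all_eq_true] at h
        have h := h (pc m) (by
          have : pc m = 1 ∨ pc m = 2 ∨ pc m = 3 ∨ pc m = 4 ∨ pc m = 5 := by omega
          simpa using this)
        simp only [Bool.or_eq_true, decide_eq_true_eq, Bool.and_eq_true, beq_iff_eq] at h
        rcases h with (((h | h) | h) | h) | h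
        · omega
        · omega
        · exfalso
          have hp : pre = [] := by simpa using h.2
          subst hp
          have hau : a = bitv m + 2 ^ 1 • u' := by
            rw [ha, pow_one, hue]; simp [expo]
          rw [hau, wVec_low _ _ _ _ (by norm_num), wVec_bitv] at h5
          omega
        · left
          rw [ha]
          refine suffix_hit _ _ _ hx ?_
          obtain ⟨j, hj⟩ := pc_one m hm32 h.1
          rw [← hue, hj, bitv_pow]
          refine hit_one j u' (fun i => ?_)
          have : degA u' = d / 2 := by omega
          rw [this]
          exact not_pow h.2 i
        · refine ih _ (m :: pre) ?_ h u' (by omega) a ?_ h5 hpos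
          · intro m' hm'
            rcases List.mem_cons.1 hm' with rfl | h'
            · exact hm32
            · exact hpre _ h'
          · rw [ha, List.reverse_cons, expo_append, List.length_reverse, add_assoc, ← hue, List.length_cons,
              pow_succ, smul_add, smul_smul]
            simp [expo]

theorem adm_good {S T : ℕ → Bool} (hS : TabOK S false) (hT : TabOK T true)
    (hb : badW.all (fun ws => cover S T ws []) = true) (a : Fin 5 →₀ ℕ) (hd : degA a = 67)
    (hA : Admissible a) (h5 : wVec a 0 < 5) (hpos : ∀ j, 0 < a j) :
    ∃ w ∈ goodW, wVec a = fun t => w.getD t 0 := by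
  rcases coverW_thm hS hT hb 8 67 [] (by simp) coverW_start a hd a (by simp [expo]) h5 hpos with h | h
  · exact absurd hA h.not_adm
  · exact h

def sprT : ℕ := 21063479945868904997810234307850232149250442696473116676629016062404840054566123182339554981243888496581793079558294675963115224732611649119421229643766393065372947490839987094074791917631875065455332476780148631978517168251362853308234359597268845706311222870483338832698070907914726490536739418918457313122531994460176010261855128109376995954453188196091087984762812166516607630986608608601102883383327332879512038775306362100084543545988771744373184848727278451068551240757211092836249416155017270133931402750667889203338769887381934906315412875128938893753922862697378197087312494661212487682246166335434847248167213196675556163895432806363943632630694893306994723911826348589610817923377663790562536040726399321459308762437145307149439439018877465824238107602368989332709484167667005600426831382442934272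

def sqTab : List (List ℕ) := [[0],
[1, 2],
[2, 4],
[3, 4, 5, 6],
[4, 8],
[5, 6, 9, 10],
[6, 8, 10, 12],
[7, 8, 9, 10, 11, 12, 13, 14],
[8, 16],
[9, 10, 17, 18],
[10, 12, 18, 20],
[11, 12, 13, 14, 19, 20, 21, 22],
[12, 16, 20, 24],
[13, 14, 17, 18, 21, 22, 25, 26],
[14, 16, 18, 20, 22, 24, 26, 28],
[15, 16, 17, 18, 19, 20, 21, 22, 23, 24, 25, 26, 27, 28, 29, 30],
[16, 32],
[17, 18, 33, 34],
[18, 20, 34, 36],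
[19, 20, 21, 22, 35, 36, 37, 38],
[20, 24, 36, 40],
[21, 22, 25, 26, 37, 38, 41, 42],
[22, 24, 26, 28, 38, 40, 42, 44],
[23, 24, 25, 26, 27, 28, 29, 30, 39, 40, 41, 42, 43, 44, 45, 46],
[24, 32, 40, 48],
[25, 26, 33, 34, 41, 42, 49, 50],
[26, 28, 34, 36, 42, 44, 50, 52],
[27, 28, 29, 30, 35, 36, 37, 38, 43, 44, 45, 46, 51, 52, 53, 54],
[28, 32, 36, 40, 44, 48, 52, 56],
[29, 30, 33, 34, 37, 38, 41, 42, 45, 46, 49, 50, 53, 54, 57, 58],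
[30, 32, 34, 36, 38, 40, 42, 44, 46, 48, 50, 52, 54, 56, 58, 60],
[31, 32, 33, 34, 35, 36, 37, 38, 39, 40, 41, 42, 43, 44, 45, 46, 47, 48, 49, 50, 51, 52, 53, 54, 55, 56, 57, 58, 59, 60, 61, 62]]

def sqL (h : ℕ) : List ℕ := sqTab.getD h []


def spr (c : ℕ) : ℕ := Nat.mod (Nat.shiftRight sprT (Nat.mul 21 c)) 2097152

def force {A : Type} (x : ℕ) (f : ℕ → A) : A := Nat.rec (f 0) (fun n _ => f (Nat.succ n)) x

def fm (l : List ℕ) (f : ℕ → List ℕ → List ℕ) (e : List ℕ) : List ℕ := List.rec e (fun c _ ih => f c ih) l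

def step (h i acc wacc : ℕ) (k : ℕ → ℕ → ℕ → List ℕ → List ℕ) (e : List ℕ) : List ℕ :=
  fm (sqL h) (fun c ih => Bool.rec ih (force (Nat.sub (Nat.add h i) c) fun i' =>
      force (Nat.add (Nat.mul acc 128) c) fun acc' => force (Nat.add wacc (spr c)) fun wacc' => k i' acc' wacc' ih) (Nat.ble c (Nat.add h i))) e

def leaf (i acc wacc : ℕ) (e : List ℕ) : List ℕ :=
   Bool.rec e (force (Nat.add (Nat.mul wacc 34359738368) acc) (fun N => N :: e)) (Nat.beq i 0)

def gen (l : List ℕ) (i acc wacc : ℕ) : List ℕ :=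
  match l with
  | [h0,h1,h2,h3,h4] => 
    force h0 fun h0 => force h1 fun h1 => force h2 fun h2 => force h3 fun h3 => force h4 fun h4 => 
    step h0 i acc wacc (fun i acc wacc => step h1 i acc wacc (fun i acc wacc => step h2 i acc wacc 
    (fun i acc wacc => step h3 i acc wacc (fun i acc wacc => step h4 i acc wacc leaf)))) []
  | _ => []

def mergeC : ℕ → List ℕ → List ℕ → List ℕ
  | 0, l, l' => l ++ l'
  | f + 1, l, l' => match l with
    | [] => l'
    | a :: t => match l' with
      | [] => a :: t
      | b :: t' => bif Nat.beq a b then mergeC f t t' else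
        bif Nat.ble a b then a :: mergeC f t (b :: t') else b :: mergeC f (a :: t) t'

def pairUp : List (List ℕ) → List (List ℕ)
  | a :: b :: r => mergeC 5000 a b :: pairUp r
  | r => r

def mergeAll : ℕ → List (List ℕ) → List ℕ
  | 0, L => L.flatten
  | f + 1, L => mergeAll f (pairUp L)

def unp32 (h : ℕ) : List ℕ :=
  [h / 1048576 % 32, h / 32768 % 32, h / 1024 % 32, h / 32 % 32, h % 32]

def dec : ℕ → ℕ → List ℕ
  | 0, _ => []
  | f + 1, k => bif Nat.ble k 1 then [] else k % 32 :: dec f (k / 32)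

def expN : List ℕ → ℕ → ℕ
  | [], _ => 0
  | m :: l, j => (m.testBit j).toNat + 2 * expN l j

def wl (l : List ℕ) : List ℕ := [expN l 0, expN l 1, expN l 2, expN l 3, expN l 4]

def pkL (acc wacc : ℕ) (cs : List ℕ) : ℕ :=
  (wacc + (cs.map spr).sum) * 34359738368 + cs.foldl (fun x c => x * 128 + c) acc

def isSingle (pw : ℕ) : List ℕ → Bool
  | [x] => Nat.beq x pw
  | _ => false

def chk2 (tail : Bool) (s d pw : ℕ) (hs : List ℕ) : Bool :=
  (hs.all fun h => Nat.blt (unp32 h).sum d && (Nat.blt d ((unp32 h).sum + 2 ^ s) || tail)) &&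
  isSingle pw (mergeAll 12 ((hs.flatMap fun h =>
    (gen (unp32 h) (d - (unp32 h).sum) 0 0).filter (Nat.ble pw)).map fun N => [N]))

def chk1 (tail : Bool) (k : ℕ) (l hs : List ℕ) : Bool :=
  Nat.beq (enc l) k && (l.all (fun m => Nat.blt m 32)) && Nat.ble l.length 7 &&
    chk2 tail l.length (wl l.reverse).sum (pkL 0 0 (wl l.reverse)) hs

def chk (tail : Bool) : List ℕ → Bool
  | [] => false
  | k :: hs => chk1 tail k (dec 7 k) hs

theorem force_eq {A : Type} (x : ℕ) (f : ℕ → A) : force x f = f x := by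
  cases x <;> rfl

theorem sqL_chk : (List.range 32).all (fun h => sqL h == sq1 7 h) = true := by decide +kernel

theorem sqL_eq (h : ℕ) (hh : h < 32) : sqL h = sq1 7 h := by
  have := List.all_eq_true.1 sqL_chk h (List.mem_range.2 hh)
  simpa using this

theorem sqL_DR {h : ℕ} (hh : h < 32) : ∀ c ∈ sqL h, h ≤ c ∧ c < 128 := by
  intro c hc
  rw [sqL_eq h hh] at hc
  have := sq1_DR 7 h (by omega) c hc
  have h1 := this.1
  have h2 := this.2.1
  omega

def genS : List ℕ → ℕ → ℕ → ℕ → List ℕ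
  | [], i, acc, wacc => if i = 0 then [wacc * 34359738368 + acc] else []
  | h :: hs, i, acc, wacc => (sqL h).flatMap fun c =>
      if c ≤ h + i then genS hs (h + i - c) (acc * 128 + c) (wacc + spr c) else []

theorem leaf_eq (i acc wacc : ℕ) (e : List ℕ) : leaf i acc wacc e = genS [] i acc wacc ++ e := by
  unfold leaf genS
  simp only [force_eq, Nat.add_eq, Nat.mul_eq]
  generalize wacc * 34359738368 + acc = N
  cases i with
  | zero => rfl
  | succ i => rfl

theorem step_eq (h : ℕ) (hs : List ℕ) (k : ℕ → ℕ → ℕ → List ℕ → List ℕ)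
    (hk : ∀ i a w e, k i a w e = genS hs i a w ++ e) (i acc wacc : ℕ) (e : List ℕ) :
    step h i acc wacc k e = genS (h :: hs) i acc wacc ++ e := by
  unfold step
  rw [genS]
  induction sqL h with
  | nil => rfl
  | cons c l ih =>
    rw [List.flatMap_cons, List.append_assoc, ← ih]
    by_cases hc : c ≤ h + i
    · have hb : Nat.ble c (Nat.add h i) = true := by rw [Nat.ble_eq]; exact hc
      rw [if_pos hc]
      have : ∀ (b : Bool) (f : ℕ → List ℕ → List ℕ), fm (c :: l) f e = f c (fm l f e) := fun _ _ => rfl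
      rw [this true]
      rw [hb]
      simp only [force_eq, hk]
      rfl
    · have hb : Nat.ble c (Nat.add h i) = false := by
        rw [Bool.eq_false_iff]; rw [Ne, Nat.ble_eq]; exact hc
      rw [if_neg hc]
      have : ∀ (b : Bool) (f : ℕ → List ℕ → List ℕ), fm (c :: l) f e = f c (fm l f e) := fun _ _ => rfl
      rw [this true]
      rw [hb]
      rfl

theorem gen_eq (h0 h1 h2 h3 h4 i acc wacc : ℕ) :
    gen [h0, h1, h2, h3, h4] i acc wacc = genS [h0, h1, h2, h3, h4] i acc wacc := by
  unfold gen
  simp only [force_eq]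
  rw [step_eq h0 [h1, h2, h3, h4], List.append_nil]
  intro i a w e
  rw [step_eq h1 [h2, h3, h4]]
  intro i a w e
  rw [step_eq h2 [h3, h4]]
  intro i a w e
  rw [step_eq h3 [h4]]
  intro i a w e
  rw [step_eq h4 []]
  exact leaf_eq

def G : List ℕ → ℕ → List (List ℕ)
  | [], i => if i = 0 then [[]] else []
  | h :: hs, i => (sqL h).flatMap fun c => if c ≤ h + i then (G hs (h + i - c)).map (fun cs => c :: cs) else []

def U : List ℕ → List (List ℕ)
  | [] => [[]]
  | h :: hs => (sqL h).flatMap fun c => (U hs).map (fun cs => c :: cs)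

theorem genS_eq (hs : List ℕ) : ∀ i acc wacc, genS hs i acc wacc = (G hs i).map (pkL acc wacc) := by
  induction hs with
  | nil => intro i acc wacc; rw [genS, G]; split_ifs <;> simp [pkL]
  | cons h hs ih =>
    intro i acc wacc
    rw [genS, G, List.map_flatMap]
    congr 1
    funext c
    split_ifs
    · rw [ih, List.map_map]
      refine List.map_congr_left fun cs _ => ?_
      rw [Function.comp_apply, pkL, pkL, List.map_cons, List.sum_cons, List.foldl_cons, add_assoc]
    · rfl

theorem U_prop (hs : List ℕ) (hh : ∀ h ∈ hs, h < 32) : ∀ cs ∈ U hs, cs.length = hs.length ∧ hs.sum ≤ cs.sum ∧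
    ∀ c ∈ cs, c < 128 := by
  induction hs with
  | nil => intro cs h; simp [U] at h; subst h; simp
  | cons h hs ih =>
    intro cs hcs
    rw [U, List.mem_flatMap] at hcs
    obtain ⟨c, hc, hcs⟩ := hcs
    rw [List.mem_map] at hcs
    obtain ⟨cs', hcs', rfl⟩ := hcs
    obtain ⟨a1, a2, a3⟩ := ih (fun x hx => hh x (by simp [hx])) cs' hcs'
    have := sqL_DR (hh h (by simp)) c hc
    refine ⟨by simp [a1], by simp; omega, ?_⟩
    intro x hx
    rcases List.mem_cons.1 hx with rfl | hx
    · exact this.2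
    · exact a3 x hx

theorem G_eq (hs : List ℕ) (hh : ∀ h ∈ hs, h < 32) : ∀ i, G hs i = (U hs).filter (fun cs => cs.sum = hs.sum + i) := by
  induction hs with
  | nil =>
    intro i
    rw [G, U]
    by_cases hi : i = 0
    · simp [hi]
    · have : ¬ (0 = i) := fun h => hi h.symm
      simp [hi, this]
  | cons h hs ih =>
    intro i
    have hh' : ∀ x ∈ hs, x < 32 := fun x hx => hh x (by simp [hx])
    rw [G, U, List.filter_flatMap]
    refine List.flatMap_congr ?_
    intro c hc
    have hc' := sqL_DR (hh h (by simp)) c hc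
    rw [List.filter_map]
    split_ifs with hci
    · rw [ih hh']
      congr 1
      refine List.filter_congr ?_
      intro cs _
      refine decide_eq_decide.2 ?_
      rw [List.sum_cons, List.sum_cons]
      omega
    · symm
      rw [List.map_eq_nil_iff, List.filter_eq_nil_iff]
      intro cs hcs
      have := (U_prop hs hh' cs hcs).2.1
      intro hcon
      have hcon := of_decide_eq_true hcon
      rw [List.sum_cons, List.sum_cons] at hcon
      omega

def cvec (cs : List ℕ) : Fin 5 →₀ ℕ := Finsupp.equivFunOnFinite.symm fun j => cs.getD j 0

theorem cvec_apply (cs : List ℕ) (j : Fin 5) : cvec cs j = cs.getD j 0 := rfl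

def ev : List (P 5) → List ℕ → P 5
  | x :: xs, c :: cs => x ^ c * ev xs cs
  | _, _ => 1

theorem U_sum (hs : List ℕ) (hh : ∀ h ∈ hs, h < 32) : ∀ xs : List (P 5), xs.length = hs.length →
    ((U hs).map (ev xs)).sum = ev (xs.map fun x => x + x ^ 2) hs := by
  induction hs with
  | nil => intro xs hx; simp [U, ev]
  | cons h hs ih =>
    intro xs hx
    cases xs with
    | nil => simp at hx
    | cons x xs =>
      have hh' : ∀ x ∈ hs, x < 32 := fun x hx => hh x (by simp [hx])
      have h32 := hh h (by simp)
      rw [U, flatMap_sum, List.map_cons, ev, sq1_pow x 7 h (by omega), ← ih hh' xs (by simpa using hx),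
        ← sqL_eq h h32, ← List.sum_map_mul_right]
      congr 2
      funext c
      rw [List.map_map, ← List.sum_map_mul_left]
      rfl

theorem len5 {A : Type} {l : List A} (h : l.length = 5) : ∃ a b c d e, l = [a, b, c, d, e] := by
  rcases l with _ | ⟨a, _ | ⟨b, _ | ⟨c, _ | ⟨d, _ | ⟨e, _ | ⟨f, l⟩⟩⟩⟩⟩⟩ <;> simp at h
  exact ⟨a, b, c, d, e, rfl⟩

theorem mono_prod (a : Fin 5 →₀ ℕ) : mono a = ∏ j, (X j : P 5) ^ (a j) := by
  rw [mono, monomial_eq, Finsupp.prod_fintype] <;> simp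

theorem ev_mono (cs : List ℕ) (h : cs.length = 5) : ev [X 0, X 1, X 2, X 3, X 4] cs = mono (cvec cs) := by
  obtain ⟨a, b, c, d, e, rfl⟩ := len5 h
  rw [mono_prod, Fin.prod_univ_five]
  simp [ev, cvec_apply, mul_assoc]

theorem ev_SqT (cs : List ℕ) (h : cs.length = 5) :
    ev ([X 0, X 1, X 2, X 3, X 4].map fun x => x + x ^ 2) cs = SqT 5 (mono (cvec cs)) := by
  obtain ⟨a, b, c, d, e, rfl⟩ := len5 h
  rw [SqT_mono, Fin.prod_univ_five]
  simp [ev, cvec_apply, mul_assoc]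

theorem degA_cvec (cs : List ℕ) (h : cs.length = 5) : degA (cvec cs) = cs.sum := by
  obtain ⟨a, b, c, d, e, rfl⟩ := len5 h
  simp [degA, Fin.sum_univ_five, cvec_apply, add_assoc]

theorem hc_filter (d : ℕ) (L : List (List ℕ)) (hL : ∀ cs ∈ L, cs.length = 5) :
    hc d ((L.map fun cs => (mono (cvec cs) : P 5)).sum) =
      ((L.filter fun cs => cs.sum = d).map fun cs => mono (cvec cs)).sum := by
  induction L with
  | nil => simp
  | cons cs L ih =>
    have h1 := hL cs (by simp)
    rw [List.map_cons, List.sum_cons, map_add, ih fun x hx => hL x (by simp [hx]), hc_mono, degA_cvec cs h1]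
    by_cases h : cs.sum = d
    · rw [if_pos h, List.filter_cons_of_pos (by simpa using h)]; simp
    · rw [if_neg h, List.filter_cons_of_neg (by simpa using h)]; simp

theorem G_sum (hs : List ℕ) (h5 : hs.length = 5) (hh : ∀ h ∈ hs, h < 32) (i : ℕ) :
    hc (hs.sum + i) (SqT 5 (mono (cvec hs))) = ((G hs i).map fun cs => mono (cvec cs)).sum := by
  have hL : ∀ cs ∈ U hs, cs.length = 5 := fun cs hcs => by rw [(U_prop hs hh cs hcs).1, h5]
  rw [G_eq hs hh, ← hc_filter _ _ hL, ← ev_SqT hs h5, ← U_sum hs hh _ (by simp [h5])]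
  congr 2
  exact List.map_congr_left fun cs hcs => ev_mono cs (hL cs hcs)

def unp (N : ℕ) : Fin 5 →₀ ℕ :=
  cvec [N / 268435456 % 128, N / 2097152 % 128, N / 16384 % 128, N / 128 % 128, N % 128]

theorem unp_pk (cs : List ℕ) (h : cs.length = 5) (hc : ∀ c ∈ cs, c < 128) : unp (pkL 0 0 cs) = cvec cs := by
  obtain ⟨a, b, c, d, e, rfl⟩ := len5 h
  simp only [List.mem_cons, List.not_mem_nil, or_false, forall_eq_or_imp, forall_eq] at hc
  obtain ⟨h1, h2, h3, h4, h5⟩ := hc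
  unfold unp
  simp only [pkL, List.foldl]
  generalize (0 + (List.map spr [a, b, c, d, e]).sum) = M
  congr 1
  simp only [List.cons.injEq, and_true]
  refine ⟨?_, ?_, ?_, ?_, ?_⟩ <;> omega

def b2 (c t : ℕ) : ℕ := (c.testBit t).toNat

def sprS (c : ℕ) : ℕ := b2 c 0 * 262144 + b2 c 1 * 32768 + b2 c 2 * 4096 + b2 c 3 * 512 +
    b2 c 4 * 64 + b2 c 5 * 8 + b2 c 6

theorem spr_chk : (List.range 128).all (fun c => Nat.beq (spr c) (sprS c)) = true := by decide +kernel

theorem spr_eq (c : ℕ) (hc : c < 128) : spr c = b2 c 0 * 262144 + b2 c 1 * 32768 + b2 c 2 * 4096 + b2 c 3 * 512 +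
    b2 c 4 * 64 + b2 c 5 * 8 + b2 c 6 :=
  Nat.eq_of_beq_eq_true (List.all_eq_true.1 spr_chk c (List.mem_range.2 hc))

theorem wVec_b2 (a : Fin 5 →₀ ℕ) (t : ℕ) : wVec a t = b2 (a 0) t + b2 (a 1) t + b2 (a 2) t + b2 (a 3) t + b2 (a 4) t := by
  unfold wVec b2
  rw [Fin.sum_univ_five]
  simp only [Bool.toNat, Bool.cond_eq_ite]

theorem b2_lt (c t : ℕ) : b2 c t < 2 := toNat_le _

theorem wk_eq (a b c d e : ℕ) (h1 : a < 128) (h2 : b < 128) (h3 : c < 128) (h4 : d < 128) (h5 : e < 128) :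
    ([a, b, c, d, e].map spr).sum = wVec (cvec [a, b, c, d, e]) 0 * 262144 + wVec (cvec [a, b, c, d, e]) 1 * 32768 +
    wVec (cvec [a, b, c, d, e]) 2 * 4096 + wVec (cvec [a, b, c, d, e]) 3 * 512 + wVec (cvec [a, b, c, d, e]) 4 * 64 +
    wVec (cvec [a, b, c, d, e]) 5 * 8 + wVec (cvec [a, b, c, d, e]) 6 := by
  have k1 := spr_eq a h1
  have k2 := spr_eq b h2
  have k3 := spr_eq c h3
  have k4 := spr_eq d h4
  have k5 := spr_eq e h5
  generalize spr = sp at k1 k2 k3 k4 k5 ⊢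
  simp only [List.map, List.sum_cons, List.sum_nil, wVec_b2]
  rw [k1, k2, k3, k4, k5]
  have e0 : cvec [a, b, c, d, e] 0 = a := rfl
  have e1 : cvec [a, b, c, d, e] 1 = b := rfl
  have e2 : cvec [a, b, c, d, e] 2 = c := rfl
  have e3 : cvec [a, b, c, d, e] 3 = d := rfl
  have e4 : cvec [a, b, c, d, e] 4 = e := rfl
  rw [e0, e1, e2, e3, e4]
  ring

theorem wVec_le (a : Fin 5 →₀ ℕ) (t : ℕ) : wVec a t ≤ 5 := by
  rw [wVec_b2]
  have := b2_lt (a 0) t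
  have := b2_lt (a 1) t
  have := b2_lt (a 2) t
  have := b2_lt (a 3) t
  have := b2_lt (a 4) t
  omega

theorem lex7 (f g : ℕ → ℕ) (hf : ∀ t, f t ≤ 5) (hg : ∀ t, g t ≤ 5) (hf' : ∀ t, 7 ≤ t → f t = 0)
    (hg' : ∀ t, 7 ≤ t → g t = 0)
    (h : f 0 * 262144 + f 1 * 32768 + f 2 * 4096 + f 3 * 512 + f 4 * 64 + f 5 * 8 + f 6 ≤
      g 0 * 262144 + g 1 * 32768 + g 2 * 4096 + g 3 * 512 + g 4 * 64 + g 5 * 8 + g 6) :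
    lexLtN f g ∨ f = g := by
  have a0 := hf 0; have a1 := hf 1; have a2 := hf 2; have a3 := hf 3; have a4 := hf 4; have a5 := hf 5; have a6 := hf 6
  have b0 := hg 0; have b1 := hg 1; have b2 := hg 2; have b3 := hg 3; have b4 := hg 4; have b5 := hg 5; have b6 := hg 6
  by_cases c : ∃ t, f t ≠ g t
  · left
    classical
    have hs := Nat.find_spec c
    have hm : ∀ t < Nat.find c, f t = g t := fun t ht => by
      have := Nat.find_min c ht; push Not at this; exact this
    refine ⟨Nat.find c, hm, ?_⟩
    generalize Nat.find c = T at hs hm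
    by_contra hlt
    have h7 : T < 7 := by
      by_contra h7
      exact hs (by rw [hf' T (by omega), hg' T (by omega)])
    interval_cases T
    · omega
    · have := hm 0 (by omega); omega
    · have := hm 0 (by omega); have := hm 1 (by omega); omega
    · have := hm 0 (by omega); have := hm 1 (by omega); have := hm 2 (by omega); omega
    · have := hm 0 (by omega); have := hm 1 (by omega); have := hm 2 (by omega); have := hm 3 (by omega); omega
    · have := hm 0 (by omega); have := hm 1 (by omega); have := hm 2 (by omega); have := hm 3 (by omega)
      have := hm 4 (by omega); omega
    · have := hm 0 (by omega); have := hm 1 (by omega); have := hm 2 (by omega); have := hm 3 (by omega)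
      have := hm 4 (by omega); have := hm 5 (by omega); omega
  · right
    push Not at c
    exact funext c

theorem lexS5 (a b c d e a' b' c' d' e' : ℕ) (h1 : a < 128) (h2 : b < 128) (h3 : c < 128) (h4 : d < 128) (h5 : e < 128)
    (h1' : a' < 128) (h2' : b' < 128) (h3' : c' < 128) (h4' : d' < 128) (h5' : e' < 128)
    (h : (((a * 128 + b) * 128 + c) * 128 + d) * 128 + e < (((a' * 128 + b') * 128 + c') * 128 + d') * 128 + e') :
    lexLtS (cvec [a, b, c, d, e]) (cvec [a', b', c', d', e']) := by
  have key : ∀ i : Fin 5, (∀ j, j < i → [a, b, c, d, e].getD j 0 = [a', b', c', d', e'].getD j 0) →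
      [a, b, c, d, e].getD i 0 < [a', b', c', d', e'].getD i 0 →
      lexLtS (cvec [a, b, c, d, e]) (cvec [a', b', c', d', e']) := fun i h h' => ⟨i, h, h'⟩
  by_cases ha : a = a'
  · by_cases hb : b = b'
    · by_cases hc : c = c'
      · by_cases hd : d = d'
        · refine key 4 ?_ (by simp; omega)
          intro j hj; fin_cases j <;> simp_all
        · refine key 3 ?_ (by simp; omega)
          intro j hj; fin_cases j <;> simp_all
      · refine key 2 ?_ (by simp; omega)
        intro j hj; fin_cases j <;> simp_all
    · refine key 1 ?_ (by simp; omega)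
      intro j hj; fin_cases j <;> simp_all
  · refine key 0 ?_ (by simp; omega)
    intro j hj; fin_cases j <;> simp_all

theorem cvec_lt (cs : List ℕ) (hc : ∀ c ∈ cs, c < 128) (j : Fin 5) : cvec cs j < 2 ^ 7 := by
  rw [cvec_apply]
  by_cases h : (j : ℕ) < cs.length
  · rw [List.getD_eq_getElem _ _ h]; exact hc _ (List.getElem_mem h)
  · rw [List.getD_eq_default _ _ (by omega)]; norm_num

theorem pk_lt (cs ws : List ℕ) (h : cs.length = 5) (h' : ws.length = 5) (hc : ∀ c ∈ cs, c < 128)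
    (hw : ∀ c ∈ ws, c < 128) (hlt : pkL 0 0 cs < pkL 0 0 ws) : monLt (cvec cs) (cvec ws) := by
  have z1 : ∀ t, 7 ≤ t → wVec (cvec cs) t = 0 := fun t ht => wVec_zero_of_lt (cvec_lt cs hc) ht
  have z2 : ∀ t, 7 ≤ t → wVec (cvec ws) t = 0 := fun t ht => wVec_zero_of_lt (cvec_lt ws hw) ht
  obtain ⟨a, b, c, d, e, rfl⟩ := len5 h
  obtain ⟨a', b', c', d', e', rfl⟩ := len5 h'
  simp only [List.mem_cons, List.not_mem_nil, or_false, forall_eq_or_imp, forall_eq] at hc hw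
  obtain ⟨h1, h2, h3, h4, h5⟩ := hc
  obtain ⟨h1', h2', h3', h4', h5'⟩ := hw
  simp only [pkL, List.foldl, zero_add, zero_mul] at hlt
  rw [wk_eq _ _ _ _ _ h1 h2 h3 h4 h5, wk_eq _ _ _ _ _ h1' h2' h3' h4' h5'] at hlt
  rcases lex7 _ _ (wVec_le (cvec [a, b, c, d, e])) (wVec_le (cvec [a', b', c', d', e'])) z1 z2 (by omega) with hh | hh
  · exact Or.inl hh
  · refine Or.inr ⟨hh, lexS5 _ _ _ _ _ _ _ _ _ _ h1 h2 h3 h4 h5 h1' h2' h3' h4' h5' ?_⟩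
    rw [hh] at hlt
    omega

theorem mergeC_sum (v : ℕ → P 5) (f : ℕ) : ∀ l l', ((mergeC f l l').map v).sum = (l.map v).sum + (l'.map v).sum := by
  induction f with
  | zero => intro l l'; simp [mergeC]
  | succ f ih =>
    intro l l'
    cases l with
    | nil => simp [mergeC]
    | cons a t =>
      cases l' with
      | nil => simp [mergeC]
      | cons b t' =>
        rw [mergeC]
        cases h : Nat.beq a b with
        | true =>
          have e := Nat.eq_of_beq_eq_true h
          subst e
          rw [cond_true, ih]
          simp only [List.map_cons, List.sum_cons]
          have := two_zero (v a)
          linear_combination -this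
        | false =>
          rw [cond_false]
          cases Nat.ble a b with
          | true => rw [cond_true, List.map_cons, List.sum_cons, ih]; simp only [List.map_cons, List.sum_cons]; ring
          | false => rw [cond_false, List.map_cons, List.sum_cons, ih]; simp only [List.map_cons, List.sum_cons]; ring

theorem pairUp_sum (v : ℕ → P 5) : ∀ L : List (List ℕ),
    ((pairUp L).map fun l => (l.map v).sum).sum = (L.map fun l => (l.map v).sum).sum
  | [] => rfl
  | [_] => rfl
  | a :: b :: r => by
    rw [pairUp, List.map_cons, List.sum_cons, mergeC_sum, pairUp_sum v r]
    simp only [List.map_cons, List.sum_cons]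
    ring

theorem mergeAll_sum (v : ℕ → P 5) (f : ℕ) : ∀ L : List (List ℕ),
    ((mergeAll f L).map v).sum = (L.map fun l => (l.map v).sum).sum := by
  induction f with
  | zero =>
    intro L
    rw [mergeAll]
    induction L with
    | nil => rfl
    | cons a L ih => rw [List.flatten_cons, List.map_append, List.sum_append, ih]; rfl
  | succ f ih => intro L; rw [mergeAll, ih, pairUp_sum]

theorem filter_sum (v : ℕ → P 5) (p : ℕ → Bool) (L : List ℕ) :
    ((L.filter p).map v).sum = (L.map v).sum + ((L.filter fun x => !p x).map v).sum := by
  induction L with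
  | nil => simp
  | cons a L ih =>
    have := two_zero (v a)
    cases h : p a with
    | true =>
      rw [List.filter_cons_of_pos h, List.filter_cons_of_neg (by simp [h])]
      simp only [List.map_cons, List.sum_cons]
      rw [ih]; ring
    | false =>
      rw [List.filter_cons_of_neg (by simp [h]), List.filter_cons_of_pos (by simp [h])]
      simp only [List.map_cons, List.sum_cons]
      rw [ih]
      linear_combination -this

theorem unp32_len (h : ℕ) : (unp32 h).length = 5 := rfl

theorem unp32_lt (h : ℕ) : ∀ x ∈ unp32 h, x < 32 := by
  intro x hx
  simp only [unp32, List.mem_cons, List.not_mem_nil, or_false] at hx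
  rcases hx with rfl | rfl | rfl | rfl | rfl <;> exact Nat.mod_lt _ (by norm_num)

theorem gen_pk (h i : ℕ) : gen (unp32 h) i 0 0 = (G (unp32 h) i).map (pkL 0 0) := by
  rw [← genS_eq, unp32, gen_eq]

theorem G_prop (h i : ℕ) (cs : List ℕ) (hcs : cs ∈ G (unp32 h) i) :
    cs.length = 5 ∧ cs.sum = (unp32 h).sum + i ∧ ∀ c ∈ cs, c < 128 := by
  rw [G_eq _ (unp32_lt h), List.mem_filter] at hcs
  have := U_prop _ (unp32_lt h) cs hcs.1
  exact ⟨this.1, of_decide_eq_true hcs.2, this.2.2⟩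

theorem one_sound (tail : Bool) (s : ℕ) (ws : List ℕ) (h5 : ws.length = 5) (hw : ∀ c ∈ ws, c < 128) (h : ℕ)
    (h1 : (unp32 h).sum < ws.sum) (h2 : ws.sum < (unp32 h).sum + 2 ^ s ∨ tail = true) :
    (((gen (unp32 h) (ws.sum - (unp32 h).sum) 0 0).filter (Nat.ble (pkL 0 0 ws))).map fun N => mono (unp N)).sum ∈
    Submodule.span (ZMod 2) {v | ∃ h : Fin 5 →₀ ℕ, degA h < degA (cvec ws) ∧
      (degA (cvec ws) < degA h + 2 ^ s ∨ tail = true) ∧ v = hc (degA (cvec ws)) (SqT 5 (mono h))} ⊔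
    RS {b | degA b = degA (cvec ws) ∧ monLt b (cvec ws)} := by
  rw [filter_sum, degA_cvec ws h5]
  have ed := degA_cvec (unp32 h) (unp32_len h)
  refine Submodule.add_mem_sup (Submodule.subset_span ⟨cvec (unp32 h), by rw [ed]; exact h1, by rw [ed]; exact h2, ?_⟩) ?_
  · have e : ws.sum = (unp32 h).sum + (ws.sum - (unp32 h).sum) := by omega
    conv_rhs => rw [e]
    rw [G_sum (unp32 h) (unp32_len h) (unp32_lt h), gen_pk, List.map_map]
    congr 1
    refine List.map_congr_left fun cs hcs => ?_
    have := G_prop h _ cs hcs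
    rw [Function.comp_apply, unp_pk cs this.1 this.2.2]
  · refine list_sum_mem ?_
    intro x hx
    rw [List.mem_map] at hx
    obtain ⟨N, hN, rfl⟩ := hx
    rw [List.mem_filter, gen_pk, List.mem_map] at hN
    obtain ⟨⟨cs, hcs, rfl⟩, hN⟩ := hN
    have hp := G_prop h _ cs hcs
    rw [unp_pk cs hp.1 hp.2.2]
    refine mono_mem_RS ⟨?_, pk_lt cs ws hp.1 h5 hp.2.2 hw ?_⟩
    · rw [degA_cvec cs hp.1, hp.2.1]; omega
    · generalize pkL 0 0 cs = A at hN
      generalize pkL 0 0 ws = B at hN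
      by_contra hle
      have : Nat.ble B A = true := by rw [Nat.ble_eq]; omega
      rw [this] at hN
      exact absurd hN (by decide)

theorem all_sound (tail : Bool) (s : ℕ) (ws : List ℕ) (h5 : ws.length = 5) (hw : ∀ c ∈ ws, c < 128) (hs : List ℕ)
    (hh : ∀ h ∈ hs, (unp32 h).sum < ws.sum ∧ (ws.sum < (unp32 h).sum + 2 ^ s ∨ tail = true)) :
    ((hs.flatMap fun h => (gen (unp32 h) (ws.sum - (unp32 h).sum) 0 0).filter
      (Nat.ble (pkL 0 0 ws))).map fun N => mono (unp N)).sum ∈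
    Submodule.span (ZMod 2) {v | ∃ h : Fin 5 →₀ ℕ, degA h < degA (cvec ws) ∧
      (degA (cvec ws) < degA h + 2 ^ s ∨ tail = true) ∧ v = hc (degA (cvec ws)) (SqT 5 (mono h))} ⊔
    RS {b | degA b = degA (cvec ws) ∧ monLt b (cvec ws)} := by
  rw [flatMap_sum]
  refine list_sum_mem ?_
  intro x hx
  rw [List.mem_map] at hx
  obtain ⟨h, hm, rfl⟩ := hx
  exact one_sound tail s ws h5 hw h (hh h hm).1 (hh h hm).2

theorem chk2_sound (tail : Bool) (s : ℕ) (ws : List ℕ) (h5 : ws.length = 5) (hw : ∀ c ∈ ws, c < 128) (hs : List ℕ)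
    (hc : chk2 tail s ws.sum (pkL 0 0 ws) hs = true) : Blk s (cvec ws) tail := by
  rw [chk2, Bool.and_eq_true] at hc
  obtain ⟨c1, c2⟩ := hc
  have hh : ∀ h ∈ hs, (unp32 h).sum < ws.sum ∧ (ws.sum < (unp32 h).sum + 2 ^ s ∨ tail = true) := by
    intro h hm
    have := List.all_eq_true.1 c1 h hm
    rw [Bool.and_eq_true, Bool.or_eq_true] at this
    refine ⟨Nat.le_of_ble_eq_true this.1, ?_⟩
    rcases this.2 with h | h
    · exact Or.inl (Nat.le_of_ble_eq_true h)
    · exact Or.inr h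
  have key := all_sound tail s ws h5 hw hs hh
  unfold Blk
  generalize hL : (hs.flatMap fun h => (gen (unp32 h) (ws.sum - (unp32 h).sum) 0 0).filter
      (Nat.ble (pkL 0 0 ws))) = L at key c2
  have e := mergeAll_sum (fun N => mono (unp N)) 12 (L.map fun N => [N])
  rw [List.map_map] at e
  have e' : ((fun l : List ℕ => (l.map fun N => (mono (unp N) : P 5)).sum) ∘ fun N => [N]) = fun N => mono (unp N) := by
    funext N; simp
  rw [e'] at e
  rw [← e] at key
  have e2 := unp_pk ws h5 hw
  generalize mergeAll 12 (L.map fun N => [N]) = M at key c2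
  generalize pkL 0 0 ws = pw at c2 e2
  match M, c2 with
  | [x], c2 =>
    have := Nat.eq_of_beq_eq_true c2
    subst this
    rw [List.map_singleton, List.sum_singleton, e2] at key
    exact key

theorem expo_expN (l : List ℕ) (j : Fin 5) : expo l j = expN l j := by
  induction l with
  | nil => rfl
  | cons m l ih => 
    rw [expo, expN, ← ih]
    simp only [Finsupp.coe_add, Pi.add_apply, Finsupp.coe_smul, Pi.smul_apply, smul_eq_mul, bitv_apply]

theorem cvec_wl (l : List ℕ) : cvec (wl l) = expo l := by
  ext j
  rw [expo_expN, cvec_apply, wl]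
  fin_cases j <;> rfl

theorem wl_lt (l : List ℕ) (hl : l.length ≤ 7) : ∀ c ∈ wl l, c < 128 := by
  have key : ∀ j : Fin 5, expN l j < 128 := fun j => by
    rw [← expo_expN]
    refine lt_of_lt_of_le (expo_lt l j) ?_
    exact (Nat.pow_le_pow_right (by norm_num) hl).trans (by norm_num)
  intro c hc
  simp only [wl, List.mem_cons, List.not_mem_nil, or_false] at hc
  rcases hc with rfl | rfl | rfl | rfl | rfl
  exacts [key 0, key 1, key 2, key 3, key 4]

theorem chk_sound (tail : Bool) (k : ℕ) (hs : List ℕ) (hc : chk tail (k :: hs) = true) (l : List ℕ)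
    (hl : ∀ m ∈ l, m < 32) (hk : enc l = k) : Blk l.length (expo l.reverse) tail := by
  rw [chk, chk1, Bool.and_eq_true, Bool.and_eq_true, Bool.and_eq_true] at hc
  obtain ⟨⟨⟨c1, c2⟩, c3⟩, c4⟩ := hc
  have hd : ∀ m ∈ dec 7 k, m < 32 := fun m hm => Nat.le_of_ble_eq_true (List.all_eq_true.1 c2 m hm)
  have e := enc_inj _ _ hd hl ((Nat.eq_of_beq_eq_true c1).trans hk.symm)
  rw [e] at c3 c4
  rw [← cvec_wl]
  refine chk2_sound tail _ _ rfl (wl_lt _ ?_) hs c4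
  rw [List.length_reverse]
  exact Nat.le_of_ble_eq_true c3

def tab : List (List ℕ) → ℕ
  | [] => 0
  | c :: L => bif Nat.ble 65536 (c.headD 0) then tab L else Nat.lor (2 ^ c.headD 0) (tab L)

theorem tab_mem (L : List (List ℕ)) (i : ℕ) (h : (tab L).testBit i = true) : ∃ c ∈ L, c.headD 0 = i := by
  induction L with
  | nil => simp [tab] at h
  | cons c L ih =>
    rw [tab] at h
    cases hb : Nat.ble 65536 (c.headD 0) with
    | true =>
      rw [hb, cond_true] at h
      obtain ⟨c, hc, e⟩ := ih h
      exact ⟨c, by simp [hc], e⟩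
    | false =>
      rw [hb, cond_false] at h
      have h : ((2 ^ c.headD 0) ||| (tab L)).testBit i = true := h
      rw [Nat.testBit_or, Bool.or_eq_true, Nat.testBit_two_pow, decide_eq_true_iff] at h
      rcases h with h | h
      · exact ⟨c, by simp, h⟩
      · obtain ⟨c, hc, e⟩ := ih h
        exact ⟨c, by simp [hc], e⟩

def tst (T : ℕ) (E : List ℕ) (k : ℕ) : Bool := T.testBit k || E.any (Nat.beq k)

theorem tab_ok (tail : Bool) (L : List (List ℕ)) (E : List ℕ) (h : L.all (chk tail) = true)
    (hE : E.all (fun k => L.any fun c => Nat.beq (c.headD 0) k) = true) : TabOK (tst (tab L) E) tail := by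
  intro l hl ht
  have : ∃ c ∈ L, c.headD 0 = enc l := by
    rw [tst, Bool.or_eq_true] at ht
    rcases ht with ht | ht
    · exact tab_mem L _ ht
    · obtain ⟨k, hk, e⟩ := List.any_eq_true.1 ht
      have := List.all_eq_true.1 hE k hk
      obtain ⟨c, hc, e'⟩ := List.any_eq_true.1 this
      exact ⟨c, hc, (Nat.eq_of_beq_eq_true e').trans (Nat.eq_of_beq_eq_true e).symm⟩
  obtain ⟨c, hc, e⟩ := this
  have h1 := List.all_eq_true.1 h c hc
  cases c with
  | nil => exact absurd h1 Bool.false_ne_true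
  | cons k hs => exact chk_sound tail k hs h1 l hl e.symm

def certS : List (List ℕ) := [
[1544,33],[1540,1025],[1284,1056],[1538,32769],[1282,32800],[1154,33792],[1537,1048577],
[1281,1048608],[1153,1049600],[1089,1081344],[1564,2083],[1308,2145],[1180,3137],[1562,65571],
[1306,65633],[1178,33858],[1558,66563],[1302,34850],[1550,33825],[1294,66656],[1174,68609],
[1166,68640],[1114,98369],[1110,100353],[1102,100384],[1561,2097187],[1305,2097249],
[1177,1049666],[1557,2098179],[1301,1050658],[1549,1049633],[1293,2098272],[1173,2100225],
[1165,2100256],[1113,1081410],[1109,1083394],[1101,1083456],[1555,2129923],[1299,1114146],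
[1547,1081377],[1291,2130016],[1171,1115138],[1163,1115200],[1543,1082369],[1287,1082400],
[1159,2132992],[1107,2195457],[1099,2195488],[1095,2196480],[1081,3145793],[1077,3147777],
[1069,3147808],[1075,3211265],[1067,3211296],[1063,3212288],[1567,2163779],[1311,1116258],
[1183,1117250],[1119,2197569],[1087,3180610],[1796,1057],[1794,32801],[1666,33793],[1410,33824],
[1793,1048609],[1665,1049601],[1409,1049632],[1601,1081345],[1345,1081376],[1217,1082368],
[50234,3211397,5275781,5275718,6324293],[42042,5308609,6422625,3276962,5374113],
[37946,3180676,3212420,6325378,5276804],[50230,3215365,5279749,5277702,6326277],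
[42038,6358052,3277892,3278884,5375012],[50222,6424609,5378081,3280961,3280930],
[42030,3215520,5279904,5277888,6326432],[37942,5314561,6425601,3281922,5379073],
[37934,5314592,6425632,3281984,5379104],[35898,3309698,5406849,5439553,6455361],
[35894,3313666,5410817,5441537,6457345],[35886,3313728,5410848,5441568,6457376],[1812,1059],
[1804,1121],[1676,3105],[1612,66593,33825],[1810,32803],[1802,32865],[1682,33795],[1426,33826],
[1674,33857],[1418,33888],[1798,66593],[1670,35841],[1414,35872],[1610,98337],[1606,99329],
[1350,99360],[1580,2098209,1049633],[1578,2129953,1081377],[1574,2130945,1082369],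
[1318,2130976,1082400],[1809,1048611],[1801,1048673],[1681,1049603],[1425,1049634],[1673,1049665],
[1417,1049696],[1797,2098209],[1669,1051649],[1413,1051680],[1617,1081347],[1361,1081378],
[1609,1081409],[1353,1081440],[1233,1082370],[1225,1082432],[1605,1083393],[1349,1083424],
[1221,1084416],[1795,2129953],[1667,2130945],[1411,2130976],[1603,1146881],[1347,1146912],
[1219,1147904],[1577,3145761],[1573,3146753],[1317,3146784],[1571,3178497],[1315,3178528],
[1187,3179520],[1820,1123],[1692,3107],[1436,3169],[1818,32867],[1690,33859],[1434,33890],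
[1814,34851],[1806,34913],[1686,35843],[1430,35874],[1678,68641],[1422,35936],[1626,98339],
[1370,98401],[1622,99331],[1366,99362],[1614,100385],[1358,99424],[1238,101377],[1230,101408],
[1817,1048675],[1689,1049667],[1433,1049698],[1813,1050659],[1805,1050721],[1685,1051651],
[1429,1051682],[1677,2100257],[1421,1051744],[1625,1081411],[1369,1081442],[1241,1082434],
[1621,1083395],[1365,1083426],[1613,1083457],[1357,1083488],[1237,1084418],[1229,1084480],
[1811,1114147],[1803,1114209],[1683,1115139],[1427,1115170],[1675,2131009],[1419,1115232],
[1799,1082401],[1671,1117185],[1415,1117216],[1619,1146883],[1363,1146914],[1611,2195489],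
[1355,1146976],[1235,1147906],[1227,1147968],[1607,2196481],[1351,2196512],[1223,1149952],
[1593,3145763],[1337,3145825],[1589,3146755],[1333,3146786],[1581,3147809],[1325,3146848],
[1205,3148801],[1197,3148832],[1587,3178499],[1331,3178530],[1579,3211297],[1323,3178592],
[1203,3179522],[1195,3179584],[1575,3212289],[1319,3212320],[1191,3181568],[1139,3244033],
[1131,3244064],[1127,3245056],[52120,132199,36967,34983,67687],[43928,132323,37091,35045,67811],
[52116,134183,35975,37959,68679],[43924,36006,134245,68710,37990],
[52108,134307,38083,36037,68803],[43916,36068,134369,38114,68834],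
[39828,72771,138275,40067,40005],[39820,72802,138337,40098,40036],
[39762,230531,233507,230469,231491],[39754,233569,230500,230562,231522],
[51096,4195431,1052775,1050791,2099303],[42904,4195555,1052899,1050853,2099427],
[51092,4197415,1051783,1053767,2100295],[42900,1051814,4197477,2100326,1053798],
[51084,4197539,1053891,1051845,2100419],[42892,1051876,4197601,1053922,2100450],
[38804,2104387,4201507,1055875,1055813],[38796,2104418,4201569,1055906,1055844],
[51032,4227175,1179751,1114279,2162791],[42840,4227299,1179875,1114341,2162915],
[50904,2131079,1085511,4228167,1180743,2132039,1116231,2163783],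
[42712,4228198,1085542,1180774,1116262,1082566,2131110,2163814,2132070],
[50648,1183843,2164835,1116325,4231267,2164837,4326499,2164899],
[42456,1180898,4228322,2163938,1085666,1116386,2131172,2132194],
[38616,1182851,4328483,4232259,1182789,2135171,2136131,2135109,1086534,1117254,2231363,2167875],
[38360,1182820,4328545,1182882,4232290,2135140,1086658,2136162,2135202,1117378,2167906,2231394],
[51028,2163783,1118247,2229287,1115271,2164775,4260903],
[42836,1118309,2229349,4260965,1116325,2164837,1115302,2163814],
[51020,1183843,4231267,1085542,2134117,1118371,2166883],
[42828,1118433,1115364,2229473,2163938,4261089,2164961],[50900,4230151,1182727,1119239,2165767],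
[42708,1084550,4230182,1182758,1117254,1119270,2165798,1086534,2133062],
[50644,1087619,1120293,1185827,2168867,4233251,1120323,1087557,2136131],
[42452,1182820,4230244,1117348,1119332,2165860],[50892,1182851,4230275,1119363,1117317,2165891],
[42700,2165860,4263010,4230244,1182820,2165858,2231394,4328545,1119394],
[50636,1182913,1117348,2167969,2165922,4263073,2165953,1120417,1182882],
[42444,4230368,1182944,1119456,2165984],[38612,4234243,1186819,1121285,2169859],
[38356,4234274,1186850,1121346,2137124,2169890,1088642,2137154],
[38604,2235425,1121316,4267041,1121409,2169890,2169921],[38348,4234336,1186912,1121440,2169952],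
[51026,4292647,1147015,1212487,2195527],[42834,1147046,4292709,2195558,1212518],
[51018,4292771,1212611,1147077,2195651],[42826,1147108,4292833,1212642,2195682],
[38738,4296739,1151107,2262147,4359235,1151045,2262085,1213510,2294851,2199619,2263107],
[38730,4296801,1151076,1151138,2262116,4359266,1214626,1246370,2294882,2199650,2263138],
[50898,4293639,1150983,1214471,2197511],
[42706,4293670,1148038,1151014,2196550,1213510,2197542,1214502],
[50642,1249315,4391971,1246339,1247299,1247269,1246277,2294851,2295843],
[42450,2262116,4293732,1246308,1151076,1149092,2197604],
[50890,4293763,1151107,2262147,1149061,1246339,2197635],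
[42698,1151076,1247330,1151138,4296801,1216610,2199650],
[50634,4293825,1151169,1148100,1246401,2262209,2197697,2196674],
[42442,4293856,1151200,1214688,2197728],[38610,1152006,4295685,2198534,1215494],
[38354,1150084,4295716,1215556,1152068,2198596],[38602,1150084,4295809,1152130,2198658,1215618],
[38346,1152192,4295840,2198720,1215680],[50886,4297731,1218563,1153029,2201603],
[42694,2264130,1218594,4361250,2296866,1215618,2264100,2266146],
[50630,1218625,1153153,4298785,2201634,1218594,1153060,2201665],
[42438,4297824,1218656,1153184,2201696],[38598,1154052,4299777,1219586,2202626],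
[38342,1154176,4299808,1219648,2202688],[36690,2326595,4423715,1278083,1278021],
[36682,2326626,4423777,1278114,1278052],[38706,3277955,3280931,3213379,5310531,3277893],
[38698,3280993,3277986,3277924,5310562,3213410],[38705,7341187,7344163,7341125,7342147],
[38697,7344225,7341156,7341218,7342178],[36657,7372931,7471139,7372869,7405635],
[36649,7471201,7372900,7372962,7405666],[38718,3184838,6330563,3217605,3282117,5281989],
[36670,6489283,3313861,5440709,3343558,3344581],[1822,66659],[1694,68643],[1438,35938],
[1630,99395],[1374,100449],[1246,101410],[1821,2098275],[1693,2100259],[1437,1051746],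
[1629,1083459],[1373,1083490],[1245,1084482],[1819,2130019],[1691,2131011],[1435,2131042],
[1815,1116195],[1807,2132065],[1687,2132995],[1431,1117218],[1679,2165793],[1423,2133088],
[1627,2195491],[1371,1146978],[1243,1147970],[1623,2196483],[1367,2196514],[1615,1148993],
[1359,2196576],[1239,1149954],[1231,1150016],[1597,3146819],[1341,3147873],[1213,3148834],
[1595,3178563],[1339,3211361],[1211,3179586],[1591,3180547],[1335,3212322],[1583,3212353],
[1327,3180640],[1207,3214337],[1199,3214368],[1147,3244066],[1143,3245058],[1135,3245120],
[1823,1116259],[1695,1117251],[1439,1117282],[1631,2196547],[1375,1149026],[1247,2198562],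
[1599,3180611],[1343,3180642],[1215,3214401],[1151,3246145],[1922,33825],[1921,1049633],
[1857,1081377],[1729,1082369],[1473,1082400],[1938,33827],[1930,33889],[1926,35873],[1862,99361],
[1830,2130977,1082401],[1937,1049635],[1929,1049697],[1925,1051681],[1873,1081379],[1865,1081441],
[1745,1082371],[1489,1082402],[1737,1082433],[1481,1082464],[1861,1083425],[1733,1084417],
[1477,1084448],[1923,2130977],[1859,1146913],[1731,1147905],[1475,1147936],[1829,3146785],
[1827,3178529],[1699,3179521],[1443,3179552],[54490,1248325,1251363,1217573,1248294,2266149],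
[46298,1251425,2266273,1217697,1248449,1248418],
[54458,3184678,6330403,3184709,6360101,5311526,5377061,3214469,5311557,5281829,5313573],
[46266,5281890,5311681,3184740,6330465,5313697,5377185,5281953,3214500,5311650,6360225,3184833],
[52346,3375142,6520867,3375173,5472293],[44154,5472417,6520929,3375266,3375297],
[52342,3376134,6521859,3377157,5473285],[44150,5473316,3376196,6521890,3377188],
[52334,3376258,5473409,3377281,6521921],[44142,3376320,6521952,3377312,5473440],
[40054,5477377,6523905,3380226,3381249],[40046,5477408,6523936,3380288,3381280],
[52345,7438374,7438405,7503909,7536675],[44153,7438498,7536737,7438529,7504033],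
[52341,7439366,7440389,7504901,7537667],[44149,7537698,7440420,7439428,7504932],
[52333,7440513,7439490,7505025,7537729],[44141,7439552,7440544,7505056,7537760],
[40053,7443458,7539713,7444481,7508993],[40045,7443520,7539744,7444512,7509024],
[1281842,7708710,7807011,7800067,14910723,14910537,7704835,11994243,7774275,7702789,15107139,15041605,7701642,7774245,14910597,7767174,11962499,7767301,11961477,14058627,7770243],
[1281834,14910568,7701828,9899201,13862056,6755489,9901217,7800098,7805089,7708865,7573668,11764936,5706914,7702820,11765928,7767332,7704740,7708834,7577764,7573796,7774369],
[1950,35939],[1886,99427],[1758,101411],[1502,101473],[1949,1051747],[1885,1083491],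
[1757,1084483],[1501,1084514],[1947,2131043],[1943,2133027],[1935,2133089],[1883,1146979],
[1755,1147971],[1499,1148002],[1879,1148963],[1871,1149025],[1751,1149955],[1495,1149986],
[1743,1150017],[1487,1150048],[1853,3146851],[1725,3148835],[1469,3148897],[1851,3178595],
[1723,3179587],[1467,3179618],[1847,3180579],[1839,3212385],[1719,3181571],[1463,3181602],
[1711,3181633],[1455,3181664],[1659,3244067],[1403,3244129],[1655,3245059],[1399,3245090],
[1647,3245121],[1391,3245152],[1271,3247105],[1263,3247136],[1985,1082401],[2001,1082403],
[1993,1082465],[1989,1084449],[1987,1147937],[1955,3179553],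
[63038,3216551,6327463,5280935,3184807,5278919],[62782,3183846,5282019,6327525,3216613,5280997],
[62654,3185861,3185830,6331555,3218597,5282981],[60990,5342407,5407911,6390951,3343527,3311783],
[60734,3310822,6391013,3311845,5440739,5407973],
[60606,6458469,5409894,5442661,3312837,3315813,5411941,5409957],
[60542,3377317,3376325,5473382,6522019,5473445],[60541,7537765,7440549,7505061,7505091,7439526],
[2013,1084515],[2011,1148003],[2007,1149987],[1999,1150049],[1979,3179619],[1975,3181603],
[1967,3181665],[1911,3245091],[1903,3245153],[1775,3247137],[2015,1150051],[1983,3181667],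
[1919,3245155],[1791,3247139],[1535,3247201]]

def certT : List (List ℕ) := [
[34908,68740,101508],[33852,2100356,3148932],[33850,2195588,3244164],[33846,2199556,3248132],
[33838,2199680,3248256],[35736,37059,133283,35013,67779],[35732,39043,137251,38981,71747],
[35724,68802,38082,68772,134337],[34712,1052867,4196515,1050821,2099395],
[34708,1054851,4200483,1054789,2103363],[34700,2100418,1053890,2100388,4197569],
[1606748,12620035,3219721,3186954,10526979,6332677,5284105],
[1344604,4237604,6330664,5284136,8427812,2140456,3219752,3187016],
[1213532,12653825,5320961,10560769,3417346,3286276,9513217,5383426,9577729],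
[1147996,9765960,9733256,9734276,3313928,10781768,5540100,3442952,5637192,12878916],
[1274648,140647,134571,45415,75175,36301,71111,76135,69067],
[1272600,394475,102765,299243,166253,198893,99758,100718,329963],
[1272472,107911,110763,307303,402535,110887,174251,104653,174375,103757,207015,108871,338023,108747],
[1272216,396521,173290,103850,202089,170345,298220,77034,104684,104810,201962,109802,108778,330986],
[1272468,302219,400427,302157,171086,109646,334923],
[1272212,400489,302188,335017,171306,175305,204073,203977,334954,109770,105802],
[1272204,302436,400737,175522,204194,335202,110018],
[1241880,4203879,4197803,1061223,2106791,1052109,2102727,2107751,2100683],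
[1176344,8520939,8425707,4457707,1315051,4229485,1313005,1085806,4262125,1181934,1116526,1083822,8456427,2361579,2132334],
[1176216,1093959,1183084,1086798,1189067,4230477,1120461,8427719,4237483,4265159,2166155,4233419,1184107,2168013,1126599,4328747,4269255,4269227,2135435,4233543,4263243,2140487,2231659,2136455,2133389,2172107,8459463,1119565,1124555,8430791,2133326],
[1175960,2168230,2168261,1192291,4239715,1087852,2173283,2173285,1186153,2168233,4233577,2173347,2169193,1087914,2136426,2172325,4334947,1120618],
[1176212,8530983,8432775,4467751,1322119,2241607,1095819,4241479,8434759,1193035,1095757,8465479,2370631,2144331,1128523],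
[1175956,4238661,2235593,4267333,4336931,1125578,4234569,2239781,1092812,4332867,2366787,1191110,1094858,1318275,1191206,2235589,4234438,2141386,8428742,1322181,8428931,8461635],
[1175948,4467937,8531169,1322212,8432868,4273505,4273378,2241762,2241889,1096036,1194337,4241761,1096098,8465634,2144610,1128802,2370786],
[1239832,8520939,8425707,4235499,1188075,8455405,4261102,2167021,1181038,1118573,2171115,1115566,8456427,2164078,1116526],
[1239704,4465767,1323111,1314183,4459815,4459691,2364587,1313997,1182926,2364711,2365607,2369639,1117518,2362571,2362695],
[1239448,4465891,4459877,1314028,4459753,1323235,1314245,2364649,1183177,1314214,2231749,2364773,2365669,2362726,1117642,2362602,2369763],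
[1239700,4463659,1318027,2235469,1190989,2366539,1125454],
[1239444,4463907,1318275,1318182,2366757,1127622,1187142,2366787,1125702,1121610],
[1239436,1318244,4463969,2235810,1191330,2366818,1125826],
[1174296,4489575,4293035,1442151,2392487,1147341,2261447,2425191,2195915],
[1174168,1450087,4497511,4300971,1155463,4301095,2199757,1151309,2400423,2433127,2203851,2269383,2203975],
[1173912,4301157,1450211,4497635,1155308,4301033,1384677,1151402,2199974,1351910,2269414,2204006,2203882,2433251],
[1174164,1159431,4302087,1153293,4531239,2200718,2270471,2499623,2200845,4301870,4368427,2298957,2306087,2266190,1159214,2267213,4367435,2271277,2205742,2204750,2303111,2304043,2397261,2435111,2205959,2434119,2303051],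
[1173908,8555907,1448131,4492582,1257667,1248649,1248460,8688835,1445034,4527395,2493606,2204844,1254787,1157292,4494659,8555845,1448227,4361545,1159369,4302025,4498627,1379530,2431267,2303173,2271401,2299205,1255747,2430245,4361542,1250630,2401477,8590531,4495555,1248586,1381574,8588611,2204874,2270378,1353925,2303299,2297161,1386691,2205897,2303145,1254725,1352902,4400323,2428198],
[1173900,4305249,1356002,2431329,2304353,2300321,4499681,2496737,1386722,2208098,2273633,1159524,1353956,1452257,4397281,1159586,8591585,2402530],
[1238808,12584171,3150189,9441515,5245293,6293741,3147182,3148142,10488043],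
[1238680,3155335,3158187,9449575,12592231,3158311,5253291,3152077,5253415,3151181,6301863,3156295,10496103,3156171],
[1238424,12586217,5252330,3151274,6296937,5249385,9440492,2108650,3152108,3152234,6296810,3157226,3156202,10489066],
[1238676,9444491,12590123,9444429,5250126,3157070,10493003],
[1238420,12590185,9444460,10493097,5250346,5254345,6298921,6298825,10493034,3157194,3153226],
[1238412,9444708,12590433,5254562,6299042,10493282,3157442],
[1173272,12615915,3277165,9568491,5308781,6357229,3178926,3211630,10551531],
[1173144,3285287,12623975,3187079,3285163,9576551,3182798,3186893,9511079,5316807,3219659,10559591,3219783],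
[1172888,3186924,3285349,12624099,3285225,9576675,3183046,3215782,9511141,3215813,3187141,3215785,3219814,5316838,10559715,3219690],
[1173140,9702535,12848167,12621895,10530855,9515047,10753063,5281870,9476235,9705511,9480327,9574471,9476173,3188814,10528839,9513031,9508939,10751047,10524747],
[1172884,3256488,3256516,3223718,10556613,4305187,12654755,9515171,3223845,9577667,3184010,6362409,3183948,10560707,3216714,3184940,6366405,5511363,3217706,10557731,3190954,5320899,5313834,5511459,6369443,3256643,5380419,3282218,6363429,3191171,6428963,12657827,5380291,3223875,6367523,6362309],
[1172876,12848353,9702628,9476452,12622050,5282242,9480420,9482466,9704674,9476514,10751202,9513186,10525026,9574626,3189186,9509218,10528994],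
[1173074,9666699,12812331,9666637,5472334,3506254,10715211]]

def bigS : List ℕ := [1281842, 1281834]

def bigT : List ℕ := [1606748, 1344604, 1213532, 1147996, 1274648, 1272600, 1272472, 1272216, 1272468, 1272212,
  1272204, 1241880, 1176344, 1176216, 1175960, 1176212, 1175956, 1175948, 1239832, 1239704,
  1239448, 1239700, 1239444, 1239436, 1174296, 1174168, 1173912, 1174164, 1173908, 1173900,
  1238808, 1238680, 1238424, 1238676, 1238420, 1238412, 1173272, 1173144, 1172888, 1173140,
  1172884, 1172876, 1173074]

theorem certS_ok : certS.all (chk false) = true := by decide +kernel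

theorem certT_ok : certT.all (chk true) = true := by decide +kernel

theorem bigS_ok : bigS.all (fun k => certS.any fun c => Nat.beq (c.headD 0) k) = true := by decide +kernel

theorem bigT_ok : bigT.all (fun k => certT.any fun c => Nat.beq (c.headD 0) k) = true := by decide +kernel

theorem cover_force : force (tab certS) (fun S => force (tab certT) fun T =>
    badW.all fun ws => cover (tst S bigS) (tst T bigT) ws []) = true := by decide +kernel

theorem adm_weight (a : Fin 5 →₀ ℕ) (hd : degA a = 67)
    (hA : Admissible a) (h5 : wVec a 0 < 5) (hpos : ∀ j, 0 < a j) :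
    ∃ w ∈ goodW, wVec a = fun t => w.getD t 0 := by
  have h := cover_force
  rw [force_eq, force_eq] at h
  exact adm_good (tab_ok false certS bigS certS_ok bigS_ok) (tab_ok true certT bigT certT_ok bigT_ok) h a hd hA h5 hpos

def key {n : ℕ} (a : Fin n →₀ ℕ) : Lex (ℕ → ℕ) ×ₗ Lex (Fin n → ℕ) := toLex (toLex (wVec a), toLex (a : Fin n → ℕ))

theorem key_inj {n : ℕ} {a b : Fin n →₀ ℕ} (h : key a = key b) : a = b := by
  have h2 : ((toLex (wVec a), toLex (a : Fin n → ℕ)) : Lex (ℕ → ℕ) × Lex (Fin n → ℕ)) =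
    (toLex (wVec b), toLex (b : Fin n → ℕ)) := h
  have := (Prod.mk.inj h2).2
  exact DFunLike.coe_injective this

theorem monLt_key {n : ℕ} (a b : Fin n →₀ ℕ) : monLt a b ↔ key a < key b := by
  unfold key
  rw [Prod.Lex.toLex_lt_toLex]
  rfl

def clL : P 5 →ₗ[ZMod 2] QP 5 67 :=
  ((hitSub 5 67).comap (homSub 5 67).subtype).mkQ ∘ₗ
    LinearMap.codRestrict (homSub 5 67) (hc 67)
      (fun f => (mem_homogeneousSubmodule _ _).2 (homogeneousComponent_isHomogeneous 67 f))

theorem cls_eq (f : P 5) : cls 5 67 f = clL f := rfl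

theorem hc_id {n d : ℕ} {p : P n} (hp : p ∈ RS {a | degA a = d}) : hc d p = p := by
  refine RS_ind (Q := fun p => hc d p = p) ?_ (by simp) ?_ hp
  · intro a ha
    have ha : degA a = d := ha
    rw [hc_mono, if_pos ha]
  · intro p q h h'
    rw [map_add, h, h']

theorem mkQ_eq (f : homSub 5 67) : ((hitSub 5 67).comap (homSub 5 67).subtype).mkQ f = clL (f : P 5) := by
  unfold clL
  rw [LinearMap.comp_apply]
  congr 1
  apply Subtype.ext
  exact (hc_id (hom_iff.1 f.2)).symm

theorem cl_zero {p : P 5} (hp : p ∈ RS {a | degA a = 67}) : clL p = 0 ↔ p ∈ HS 5 67 := by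
  unfold clL
  rw [LinearMap.comp_apply, Submodule.mkQ_apply, Submodule.Quotient.mk_eq_zero, Submodule.mem_comap, hitSub_eq,
    Submodule.subtype_apply, LinearMap.codRestrict_apply, hc_id hp]

def ones : Fin 5 →₀ ℕ := Finsupp.equivFunOnFinite.symm fun _ => 1

theorem ones_apply (j : Fin 5) : ones j = 1 := rfl

theorem degA_ones : degA ones = 5 := by simp [degA, ones_apply]

theorem wVec_ones : wVec ones 0 = 5 := by simp [wVec, ones_apply]

def AA : Set (Fin 5 →₀ ℕ) := {b | degA b = 67 ∧ (∀ j, 0 < b j) ∧ wVec b 0 < 5}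

theorem odd_of_wVec {a : Fin 5 →₀ ℕ} (h : ¬ ∀ i, Odd (a i)) : wVec a 0 < 5 := by
  push Not at h
  obtain ⟨i, hi⟩ := h
  unfold wVec
  have e : (5 : ℕ) = ∑ j : Fin 5, 1 := by simp
  refine lt_of_lt_of_eq ?_ e.symm
  refine Finset.sum_lt_sum (fun j _ => by split_ifs <;> omega) ⟨i, Finset.mem_univ i, ?_⟩
  rw [Nat.testBit_zero, if_neg]
  · norm_num
  · have := Nat.not_odd_iff.1 hi
    simp [this]

theorem S5_mono (a : Fin 5 →₀ ℕ) : S5 (mono a) = if ∀ i, Odd (a i) then mono (half a) else 0 := by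
  have : (mono a : P 5) = basisMonomials (Fin 5) (ZMod 2) a := by
    rw [coe_basisMonomials]; rfl
  rw [this, S5, Module.Basis.constr_basis]
  rfl

theorem decomp {p : P 5} (hp : p ∈ RS {a | degA a = 67 ∧ ∀ j, 0 < a j}) :
    p + mono ones * (S5 p) ^ (2 ^ 1) ∈ RS AA := by
  refine RS_ind (Q := fun p => p + mono ones * (S5 p) ^ (2 ^ 1) ∈ RS AA) ?_ (by simp) ?_ hp
  · intro a ha
    rw [S5_mono]
    split_ifs with h
    · rw [← mono_smul, ← mono_add]
      have : ones + 2 ^ 1 • half a = a := by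
        ext j
        have := Nat.odd_iff.1 (h j)
        have e : half a j = a j / 2 := rfl
        simp only [Finsupp.coe_add, Pi.add_apply, Finsupp.coe_smul, Pi.smul_apply, smul_eq_mul, ones_apply, e]
        omega
      rw [this, two_zero]
      exact zero_mem _
    · rw [zero_pow (by norm_num), mul_zero, add_zero]
      exact mono_mem_RS ⟨ha.1, ha.2, odd_of_wVec h⟩
  · intro p q h h'
    have := add_mem h h'
    rw [map_add, pow2_add]
    convert this using 1
    ring

theorem phi_hit {q : P 5} (hq : IsHit 5 31 q) : mono ones * q ^ (2 ^ 1) ∈ HS 5 67 ⊔ RS AA := by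
  refine z2_span_ind (Q := fun q => mono ones * q ^ (2 ^ 1) ∈ HS 5 67 ⊔ RS AA) ?_ (by simp) ?_ (hit_span hq)
  · rintro _ ⟨a, ha, rfl⟩
    have := L1 1 ones (fun j => by rw [ones_apply]; norm_num) (degA a) 31 ha (mono a) (mono_mem_RS rfl)
    rw [degA_ones] at this
    refine sup_le_sup_left (RS_mono ?_) _ this
    rintro b ⟨h1, h2, t, ht, h3⟩
    refine ⟨h1, fun j => lt_of_lt_of_le (by rw [ones_apply]; norm_num) (h2 j), ?_⟩
    have : t = 0 := by omega
    subst this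
    have := h3.2
    rwa [wVec_ones] at this
  · intro p q h h'
    rw [pow2_add, mul_add]
    exact add_mem h h'

theorem K_red {p : P 5} (hp : p ∈ RS {a | degA a = 67 ∧ ∀ j, 0 < a j}) (h : IsHit 5 31 (S5 p)) :
    p ∈ HS 5 67 ⊔ RS AA := by
  have h1 := Submodule.mem_sup_right (S := HS 5 67) (decomp hp)
  have := sub_mem h1 (phi_hit h)
  rwa [add_sub_cancel_right] at this

open Classical in
def pr : P 5 →ₗ[ZMod 2] P 5 :=
  (basisMonomials (Fin 5) (ZMod 2)).constr (ZMod 2) fun a => if ∀ i, 0 < a i then mono a else 0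

theorem pr_pos {a : Fin 5 →₀ ℕ} (h : ∀ i, 0 < a i) : pr (mono a) = mono a := by
  have : (mono a : P 5) = basisMonomials (Fin 5) (ZMod 2) a := by
    rw [coe_basisMonomials]; rfl
  rw [this, pr, Module.Basis.constr_basis, if_pos h, this]

theorem pr_neg {a : Fin 5 →₀ ℕ} (h : ¬ ∀ i, 0 < a i) : pr (mono a) = 0 := by
  have : (mono a : P 5) = basisMonomials (Fin 5) (ZMod 2) a := by
    rw [coe_basisMonomials]; rfl
  rw [this, pr, Module.Basis.constr_basis, if_neg h]

theorem pr_RS {A : Set (Fin 5 →₀ ℕ)} {p : P 5} (hp : p ∈ RS A) : pr p ∈ RS {a | a ∈ A ∧ ∀ i, 0 < a i} := by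
  refine RS_ind (Q := fun p => pr p ∈ RS {a | a ∈ A ∧ ∀ i, 0 < a i}) ?_ (by simp) ?_ hp
  · intro a ha
    by_cases h : ∀ i, 0 < a i
    · rw [pr_pos h]; exact mono_mem_RS ⟨ha, h⟩
    · rw [pr_neg h]; exact zero_mem _
  · intro p q h h'
    rw [map_add]; exact add_mem h h'

theorem pr_id {p : P 5} (hp : p ∈ RS {a | ∀ i, 0 < a i}) : pr p = p := by
  refine RS_ind (Q := fun p => pr p = p) ?_ (by simp) ?_ hp
  · intro a ha
    exact pr_pos ha
  · intro p q h h'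
    rw [map_add, h, h']

theorem pr_hit {d : ℕ} {p : P 5} (hp : p ∈ HS 5 d) : pr p ∈ HS 5 d := by
  refine z2_span_ind (Q := fun p => pr p ∈ HS 5 d) ?_ (by simp) ?_ (hit_span hp)
  · rintro _ ⟨a, ha, rfl⟩
    have hh := hc_RS (d := d) (SqT_DR a)
    by_cases h : ∀ i, 0 < a i
    · rw [pr_id]
      · exact hit_of (mono_mem_RS rfl) ha
      · refine RS_mono ?_ hh
        intro c hc i
        exact lt_of_lt_of_le (h i) (hc.1 i).1
    · push Not at h
      obtain ⟨i, hi⟩ := h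
      have := pr_RS hh
      rw [mem_RS_iff] at this
      have e : (pr (hc d (SqT 5 (mono a)))) = 0 := by
        rw [← support_eq_empty, Finset.eq_empty_iff_forall_notMem]
        intro c hc
        have h1 := this c hc
        have h2 := h1.2 i
        have h3 := (h1.1.1 i).2.1
        omega
      rw [e]
      exact zero_mem _
  · intro p q h h'
    rw [map_add]; exact add_mem h h'

theorem fin_deg (n d : ℕ) : {a : Fin n →₀ ℕ | degA a = d}.Finite := by
  refine Set.Finite.subset (Set.Finite.preimage (f := fun a : Fin n →₀ ℕ => (a : Fin n → ℕ))
    (DFunLike.coe_injective.injOn) (Set.finite_Iic (fun _ : Fin n => d))) ?_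
  intro a ha i
  have ha : degA a = d := ha
  show a i ≤ d
  rw [← ha]
  exact Finset.single_le_sum (f := fun j => a j) (fun _ _ => Nat.zero_le _) (Finset.mem_univ i)

theorem wVec_mono {n : ℕ} {a b : Fin n →₀ ℕ} (h : monLt a b) : wVec a 0 ≤ wVec b 0 := by
  rcases h with ⟨i, h1, h2⟩ | h
  · rcases Nat.eq_zero_or_pos i with rfl | hi
    · exact h2.le
    · exact (h1 0 hi).le
  · rw [h.1]

theorem span_ind (W : Submodule (ZMod 2) (QP 5 67))
    (hW : ∀ a ∈ AA, Admissible a → clL (mono a) ∈ W) : ∀ a ∈ AA, clL (mono a) ∈ W := by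
  by_contra hcon
  push Not at hcon
  obtain ⟨a0, h0, h0'⟩ := hcon
  obtain ⟨a, ⟨haA, haW⟩, hmin⟩ := Set.exists_min_image {a | a ∈ AA ∧ clL (mono a) ∉ W} key
    ((fin_deg 5 67).subset fun a ha => ha.1.1) ⟨a0, h0, h0'⟩
  apply haW
  by_cases hA : Admissible a
  · exact hW a haA hA
  · have hI := inad_of_not hA
    rw [haA.1] at hI
    obtain ⟨u, hu, v, hv, e⟩ := Submodule.mem_sup.1 hI
    have e' := congrArg pr e
    rw [pr_pos haA.2.1, map_add] at e'
    have hv' := pr_RS hv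
    have hu' := pr_hit hu
    have hud : pr u ∈ RS {a | degA a = 67} := by
      have : pr u = mono a - pr v := by rw [← e']; ring
      rw [this]
      exact sub_mem (mono_mem_RS haA.1) (RS_mono (fun b hb => hb.1.1) hv')
    rw [← e', map_add, (cl_zero hud).2 hu', zero_add]
    refine RS_ind (Q := fun p => clL p ∈ W) ?_ (by simp) ?_ hv'
    · rintro b ⟨⟨hb1, hb2⟩, hb3⟩
      by_contra hb
      have hbA : b ∈ AA := ⟨hb1, hb3, lt_of_le_of_lt (wVec_mono hb2) haA.2.2⟩
      exact absurd ((monLt_key b a).1 hb2) (not_lt.2 (hmin b ⟨hbA, hb⟩))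
    · intro p q h h'
      rw [map_add]; exact add_mem h h'

theorem adm_indep {n d : ℕ} {p : P n} (hp : ∀ a ∈ p.support, degA a = d ∧ Admissible a) (hh : p ∈ HS n d) : p = 0 := by
  by_contra h0
  have hne : p.support.Nonempty := by
    rw [Finset.nonempty_iff_ne_empty, Ne, support_eq_empty]; exact h0
  obtain ⟨a, ha, hmax⟩ := Finset.exists_max_image p.support key hne
  refine Inad.not_adm ?_ (hp a ha).2
  rw [(hp a ha).1]
  have e := eq_sum_mono p
  rw [← Finset.add_sum_erase _ _ ha] at e
  refine Submodule.mem_sup.2 ⟨p, hh, ∑ b ∈ p.support.erase a, mono b, ?_, ?_⟩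
  · refine Submodule.sum_mem _ fun b hb => mono_mem_RS ?_
    rw [Finset.mem_erase] at hb
    refine ⟨(hp b hb.2).1, (monLt_key b a).2 (lt_of_le_of_ne (hmax b hb.2) ?_)⟩
    exact fun h => hb.1 (key_inj h)
  · have t := two_zero (∑ b ∈ p.support.erase a, mono b)
    linear_combination e + t

theorem disj {B C : Set (Fin 5 →₀ ℕ)} (hB : ∀ a ∈ B, degA a = 67 ∧ Admissible a)
    (hC : ∀ a ∈ C, degA a = 67 ∧ Admissible a) (hBC : ∀ a ∈ B, a ∉ C) :
    Disjoint ((RS B).map clL) ((RS C).map clL) := by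
  rw [Submodule.disjoint_def]
  rintro _ ⟨p, hp, rfl⟩ ⟨q, hq, e⟩
  have hp : p ∈ RS B := hp
  have hq : q ∈ RS C := hq
  have hs : p - q ∈ RS {a | degA a = 67 ∧ Admissible a} := sub_mem (RS_mono hB hp) (RS_mono hC hq)
  have h0 : clL (p - q) = 0 := by rw [map_sub, e, sub_self]
  rw [cl_zero (RS_mono (fun a ha => ha.1) hs)] at h0
  have := sub_eq_zero.1 (adm_indep (mem_RS_iff.1 hs) h0)
  subst this
  have : p = 0 := by
    rw [← support_eq_empty, Finset.eq_empty_iff_forall_notMem]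
    intro a ha
    exact hBC a (mem_RS_iff.1 hp a ha) (mem_RS_iff.1 hq a ha)
  rw [this, map_zero]

def BB (w : ℕ → ℕ) : Set (Fin 5 →₀ ℕ) := {a | degA a = 67 ∧ (∀ i, 0 < a i) ∧ Admissible a ∧ wVec a = w}

theorem Vw_eq (w : ℕ → ℕ) : Vw w = (RS (BB w)).map clL := by
  unfold Vw RS
  rw [Submodule.map_span]
  congr 1
  ext x
  constructor
  · rintro ⟨a, h1, h2, h3, h4, rfl⟩
    exact ⟨_, ⟨a, ⟨h1, h2, h3, h4⟩, rfl⟩, rfl⟩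
  · rintro ⟨_, ⟨a, ⟨h1, h2, h3, h4⟩, rfl⟩, rfl⟩
    exact ⟨a, h1, h2, h3, h4, rfl⟩

theorem Vw_le_K (w : ℕ → ℕ) (hw : w 0 = 3) : Vw w ≤ KSub := by
  unfold Vw KSub
  refine Submodule.span_mono ?_
  rintro _ ⟨a, h1, h2, h3, h4, rfl⟩
  refine ⟨⟨mono a, hom_iff.2 (mono_mem_RS h1)⟩, ⟨Submodule.subset_span ⟨a, h2, rfl⟩, ?_⟩, ?_⟩
  · show IsHit 5 31 (S5 (mono a))
    rw [S5_mono, if_neg]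
    · exact IsHit.zero _ _
    · intro h
      have : wVec a 0 = 5 := by
        unfold wVec
        have : ∀ j, (a j).testBit 0 = true := fun j => by
          rw [Nat.testBit_zero]; simpa using Nat.odd_iff.1 (h j)
        simp [this]
      rw [h4, hw] at this
      omega
  · rw [mkQ_eq]; rfl

theorem Vw_disj (w : ℕ → ℕ) (W : Submodule (ZMod 2) (QP 5 67))
    (hW : W ≤ (RS {a | degA a = 67 ∧ Admissible a ∧ wVec a ≠ w}).map clL) : Disjoint (Vw w) W := by
  rw [Vw_eq]
  refine Disjoint.mono_right hW (disj ?_ ?_ ?_)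
  · exact fun a h => ⟨h.1, h.2.2.1⟩
  · exact fun a h => ⟨h.1, h.2.1⟩
  · exact fun a h h' => h'.2.2 h.2.2.2

theorem Vw_le_ne {w w' : ℕ → ℕ} (t : ℕ) (h : w t ≠ w' t) :
    Vw w ≤ (RS {a | degA a = 67 ∧ Admissible a ∧ wVec a ≠ w'}).map clL := by
  rw [Vw_eq]
  refine Submodule.map_mono (RS_mono ?_)
  rintro a ⟨h1, h2, h3, h4⟩
  refine ⟨h1, h3, ?_⟩
  rw [h4]
  intro e
  exact h (congrFun e t)

theorem plus_RS {p : P 5} (h : p ∈ PplusSub 5) (h' : p ∈ homSub 5 67) : p ∈ RS {a | degA a = 67 ∧ ∀ j, 0 < a j} := by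
  have e1 : p ∈ RS {a : Fin 5 →₀ ℕ | ∀ j, 0 < a j} := by
    have h : p ∈ Submodule.span (ZMod 2) _ := h
    refine Submodule.span_mono ?_ h
    rintro _ ⟨a, ha, rfl⟩
    exact ⟨a, ha, rfl⟩
  have e2 := hom_iff.1 h'
  refine mem_RS_iff.2 fun a ha => ⟨?_, ?_⟩
  · exact mem_RS_iff.1 e2 a ha
  · exact mem_RS_iff.1 e1 a ha

/-- `K` is the internal direct sum of the three subspaces spanned by the
classes of the admissible monomials in `P_5^+` of degree `67` with weight vector
`(3,4,2,2,2)`, `(3,4,4,3,1)` and `(3,2,1,1,1,1)` respectively. -/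
theorem statement4 :
    KSub = V 0 ⊔ V 1 ⊔ V 2 ∧
    (∀ i : Fin 3, Disjoint (V i) (⨆ j ∈ ({i}ᶜ : Set (Fin 3)), V j)) := by
  have v0 : V 0 = Vw fun t => [3, 4, 2, 2, 2].getD t 0 := rfl
  have v1 : V 1 = Vw fun t => [3, 4, 4, 3, 1].getD t 0 := rfl
  have v2 : V 2 = Vw fun t => [3, 2, 1, 1, 1, 1].getD t 0 := rfl
  constructor
  · apply le_antisymm
    · have key2 := span_ind (V 0 ⊔ V 1 ⊔ V 2) (by
        intro a ha hA
        obtain ⟨w, hw, e⟩ := adm_weight a ha.1 hA ha.2.2 ha.2.1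
        have hm : clL (mono a) ∈ Vw fun t => w.getD t 0 :=
          Submodule.subset_span ⟨a, ha.1, ha.2.1, hA, e, rfl⟩
        simp only [goodW, List.mem_cons, List.not_mem_nil, or_false] at hw
        rcases hw with rfl | rfl | rfl
        · exact Submodule.mem_sup_left (Submodule.mem_sup_left hm)
        · exact Submodule.mem_sup_left (Submodule.mem_sup_right hm)
        · exact Submodule.mem_sup_right hm)
      unfold KSub
      rw [Submodule.span_le]
      rintro _ ⟨f, ⟨hf1, hf2⟩, rfl⟩
      rw [mkQ_eq]
      have hf := plus_RS hf1 f.2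
      obtain ⟨u, hu, v, hv, e⟩ := Submodule.mem_sup.1 (K_red hf hf2)
      have hud : u ∈ RS {a | degA a = 67} := by
        have : u = f - v := by rw [← e]; ring
        rw [this]
        exact sub_mem (RS_mono (fun b hb => hb.1) hf) (RS_mono (fun b hb => hb.1) hv)
      rw [← e, map_add, (cl_zero hud).2 hu, zero_add]
      refine RS_ind (Q := fun p => clL p ∈ V 0 ⊔ V 1 ⊔ V 2) key2 (by simp) ?_ hv
      intro p q h h'
      rw [map_add]; exact add_mem h h'
    · rw [v0, v1, v2]
      exact sup_le (sup_le (Vw_le_K _ rfl) (Vw_le_K _ rfl)) (Vw_le_K _ rfl)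
  · intro i
    fin_cases i
    · refine Vw_disj _ _ (iSup₂_le ?_)
      intro j hj
      fin_cases j
      · exact absurd rfl hj
      · exact Vw_le_ne 2 (by decide)
      · exact Vw_le_ne 1 (by decide)
    · refine Vw_disj _ _ (iSup₂_le ?_)
      intro j hj
      fin_cases j
      · exact Vw_le_ne 2 (by decide)
      · exact absurd rfl hj
      · exact Vw_le_ne 1 (by decide)
    · refine Vw_disj _ _ (iSup₂_le ?_)
      intro j hj
      fin_cases j
      · exact Vw_le_ne 1 (by decide)
      · exact Vw_le_ne 1 (by decide)
      · exact absurd rfl hj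

end
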